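/- Fix a real α with 0 < α < 1/2 and constants 0 < σ̲ ≤ σ̄ < ∞ and Δ̄ < ∞. For each N ≥ 1 let (Ω_N, Q_N) be a probability space carrying, for each label J ∈ {E, I}, real random variables L^J_N, U^J_N, almost surely positive random variables S^J_{l,N}, S^J_{u,N}, and a random variable R^J_N with values in [−1, 1]; let θ_{l,N} ≤ θ_{u,N} be real parameters with θ_{u,N} − θ_{l,N} ≤ Δ̄; let σ^J_{l,N}, σ^J_{u,N} ∈ [σ̲, σ̄] and ρ^J_N ∈ [−1, 1]; and let θ_N ∈ ℝ with θ_N ∉ [θ_{l,N}, θ_{u,N}]. Assume: (i) Q_N(L^J_N ≤ U^J_N) = 1 for each J and N; (ii) σ^E_{l,N} ≤ σ^I_{l,N} and σ^E_{u,N} ≤ σ^I_{u,N} for all N; (iii) for each J, along every subsequence of indices along which (σ^J_{l,N}, σ^J_{u,N}, ρ^J_N) converges to some limit (σ_l, σ_u, ρ), the random vector √N·(L^J_N − θ_{l,N}, U^J_N − θ_{u,N}) converges in distribution to (σ_l Z₁, σ_u(ρ Z₁ + √(1−ρ²) Z₂)) with Z₁, Z₂ independent standard normal, and (S^J_{l,N},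 S^J_{u,N}, R^J_N) converges in probability to (σ_l, σ_u, ρ). For each J and N, let (C^J_{l,N}, C^J_{u,N}) be random variables that Q_N-almost surely form a solution (c_l, c_u) of the problem: minimize S^J_{l,N} c_l + S^J_{u,N} c_u over (c_l, c_u) ∈ ℝ² subject to P( {−c_l ≤ Z₁} ∩ {R^J_N Z₁ ≤ c_u + √N(U^J_N − L^J_N)/S^J_{u,N} + √(1−(R^J_N)²) Z₂} ) ≥ 1 − α and P( {−c_l − √N(U^J_N − L^J_N)/S^J_{l,N} + √(1−(R^J_N)²) Z₂ ≤ R^J_N Z₁} ∩ {Z₁ ≤ c_u} ) ≥ 1 − α, where the probabilities are computed over (Z₁, Z₂) independent standard normal with the realized values of the estimators held fixed. Let CI^J_N be the random interval [L^J_N − S^J_{l,N} C^J_{l,N}/√N, U^J_N + S^J_{u,N} C^J_{u,N}/√N]. Then liminf_{N→∞} ( Q_N(θ_N ∈ CI^E_N) − Q_N(θ_N ∈ CI^I_N) ) ≤ 0. -/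

import Mathlib

open MeasureTheory ProbabilityTheory Filter

/-- The joint law of two independent standard normal random variables `(Z₁, Z₂)`. -/
noncomputable def stdPair : Measure (ℝ × ℝ) := (gaussianReal 0 1).prod (gaussianReal 0 1)

/-- The joint law of `(σ_l Z₁, σ_u (ρ Z₁ + √(1−ρ²) Z₂))`, where `Z₁, Z₂` are
independent standard normal random variables. -/
noncomputable def limitLaw (sl su r : ℝ) : Measure (ℝ × ℝ) :=
  Measure.map (fun z : ℝ × ℝ => (sl * z.1, su * (r * z.1 + Real.sqrt (1 - r ^ 2) * z.2)))
    stdPair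

/-- Feasibility of `(c_l, c_u)` in Stoye's `CI²_α` problem, with realized correlation
estimate `r` and realized scaled widths `du = √N(U − L)/S_u`, `dl = √N(U − L)/S_l`:
`P(−c_l ≤ Z₁ and r Z₁ ≤ c_u + du + √(1−r²) Z₂) ≥ 1 − α` and
`P(−c_l − dl + √(1−r²) Z₂ ≤ r Z₁ and Z₁ ≤ c_u) ≥ 1 − α`, with `(Z₁, Z₂)` independent
standard normal. -/
def CI2Feasible (α r du dl cl cu : ℝ) : Prop :=
  1 - α ≤ (stdPair {z : ℝ × ℝ |
      -cl ≤ z.1 ∧ r * z.1 ≤ cu + du + Real.sqrt (1 - r ^ 2) * z.2}).toReal ∧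
  1 - α ≤ (stdPair {z : ℝ × ℝ |
      -cl - dl + Real.sqrt (1 - r ^ 2) * z.2 ≤ r * z.1 ∧ z.1 ≤ cu}).toReal

open scoped Topology

/-- The standard normal distribution function. -/
noncomputable def stdCDF (x : ℝ) : ℝ := (gaussianReal 0 1).real (Set.Iic x)

instance nullSingletonClass_stdGaussian : NullSingletonClass (gaussianReal 0 1) :=
  nullSingletonClass_gaussianReal one_ne_zero

lemma stdPDF_eq (x : ℝ) :
    gaussianPDFReal 0 1 x = (Real.sqrt (2 * Real.pi))⁻¹ * Real.exp (-x ^ 2 / 2) := by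
  simp [gaussianPDFReal_def]

lemma continuous_stdPDF : Continuous (gaussianPDFReal 0 1) := by
  have : gaussianPDFReal 0 1 = fun x => (Real.sqrt (2 * Real.pi))⁻¹ * Real.exp (-x ^ 2 / 2) :=
    funext stdPDF_eq
  rw [this]
  fun_prop

lemma stdPDF_pos (x : ℝ) : 0 < gaussianPDFReal 0 1 x := gaussianPDFReal_pos _ _ _ one_ne_zero

lemma stdPDF_le {x y : ℝ} (h : |x| ≤ |y|) : gaussianPDFReal 0 1 y ≤ gaussianPDFReal 0 1 x := by
  have := sq_le_sq.mpr h
  simp only [stdPDF_eq]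
  gcongr

lemma stdPDF_lt {x y : ℝ} (h : |x| < |y|) : gaussianPDFReal 0 1 y < gaussianPDFReal 0 1 x := by
  have := sq_lt_sq.mpr h
  simp only [stdPDF_eq]
  gcongr

lemma stdCDF_eq_integral (x : ℝ) : stdCDF x = ∫ t in Set.Iic x, gaussianPDFReal 0 1 t := by
  rw [stdCDF, measureReal_def, gaussianReal_apply_eq_integral _ one_ne_zero, ENNReal.toReal_ofReal]
  exact integral_nonneg fun t => gaussianPDFReal_nonneg _ _ _

lemma hasDerivAt_stdCDF (x : ℝ) : HasDerivAt stdCDF (gaussianPDFReal 0 1 x) x := by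
  have hpdf := integrable_gaussianPDFReal 0 1
  have h : stdCDF = fun y => stdCDF 0 + ∫ t in (0 : ℝ)..y, gaussianPDFReal 0 1 t := by
    ext y
    rw [← intervalIntegral.integral_Iic_sub_Iic hpdf.integrableOn hpdf.integrableOn,
      ← stdCDF_eq_integral, ← stdCDF_eq_integral]
    ring
  rw [h]
  exact (intervalIntegral.integral_hasDerivAt_right hpdf.intervalIntegrable
    (stronglyMeasurable_gaussianPDFReal 0 1).stronglyMeasurableAtFilter
    continuous_stdPDF.continuousAt).const_add _

lemma continuous_stdCDF : Continuous stdCDF :=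
  continuous_iff_continuousAt.mpr fun x => (hasDerivAt_stdCDF x).continuousAt

lemma deriv_stdCDF : deriv stdCDF = gaussianPDFReal 0 1 :=
  funext fun x => (hasDerivAt_stdCDF x).deriv

lemma strictMono_stdCDF : StrictMono stdCDF :=
  strictMono_of_deriv_pos fun x => by rw [deriv_stdCDF]; exact stdPDF_pos x

lemma tendsto_stdCDF_atTop : Tendsto stdCDF atTop (𝓝 1) :=
  (tendsto_cdf_atTop (gaussianReal 0 1)).congr fun x => cdf_eq_real _ x

lemma tendsto_stdCDF_atBot : Tendsto stdCDF atBot (𝓝 0) :=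
  (tendsto_cdf_atBot (gaussianReal 0 1)).congr fun x => cdf_eq_real _ x

lemma stdCDF_lt_one (x : ℝ) : stdCDF x < 1 :=
  (strictMono_stdCDF (lt_add_one x)).trans_le measureReal_le_one

lemma stdCDF_eq_measureReal_Ici (x : ℝ) :
    stdCDF x = (gaussianReal 0 1).real (Set.Ici (-x)) := by
  have h : (gaussianReal 0 1).map (fun y => -y) = gaussianReal 0 1 := by
    simp [gaussianReal_map_neg]
  rw [stdCDF, ← h, map_measureReal_apply measurable_neg measurableSet_Iic, h]
  congr 1
  ext y
  simp

lemma stdCDF_neg (x : ℝ) : stdCDF (-x) = 1 - stdCDF x := by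
  have h := stdCDF_eq_measureReal_Ici x
  rw [measureReal_congr (Ioi_ae_eq_Ici (μ := gaussianReal 0 1)).symm, ← Set.compl_Iic,
    probReal_compl_eq_one_sub measurableSet_Iic] at h
  rw [h, stdCDF]
  ring

lemma stdCDF_zero : stdCDF 0 = 1 / 2 := by
  have := stdCDF_neg 0
  rw [neg_zero] at this
  linarith

lemma strictConcaveOn_stdCDF : StrictConcaveOn ℝ (Set.Ici 0) stdCDF := by
  refine StrictAntiOn.strictConcaveOn_of_deriv (convex_Ici 0) continuous_stdCDF.continuousOn ?_
  rw [deriv_stdCDF, interior_Ici]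
  intro x hx y hy hxy
  rw [Set.mem_Ioi] at hx hy
  exact stdPDF_lt (by rwa [abs_of_pos hx, abs_of_pos hy])

lemma exists_stdCDF_eq {p : ℝ} (h0 : 1 / 2 < p) (h1 : p < 1) : ∃ z, 0 < z ∧ stdCDF z = p := by
  obtain ⟨M, hM, hM0⟩ := ((tendsto_stdCDF_atTop.eventually (lt_mem_nhds h1)).and
    (eventually_gt_atTop 0)).exists
  obtain ⟨z, hz, hzp⟩ := intermediate_value_Icc hM0.le continuous_stdCDF.continuousOn
    (show p ∈ Set.Icc (stdCDF 0) (stdCDF M) from ⟨by rw [stdCDF_zero]; exact h0.le, hM.le⟩)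
  refine ⟨z, lt_of_le_of_ne hz.1 ?_, hzp⟩
  rintro rfl
  rw [stdCDF_zero] at hzp
  exact h0.ne hzp

/-- Critical value of the two-sided problem at scaled width `d`. -/
lemma exists_stdCDF_add_eq {α d : ℝ} (hα : 0 < α) (hα' : α < 1 / 2) (hd : 0 ≤ d) :
    ∃ c, 0 < c ∧ stdCDF c + stdCDF (c + d) = 2 - α := by
  obtain ⟨M, hM0, hM⟩ := exists_stdCDF_eq (p := 1 - α / 2) (by linarith) (by linarith)
  have hcont : Continuous fun x => stdCDF x + stdCDF (x + d) := by
    have := continuous_stdCDF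
    fun_prop
  have h0 : stdCDF 0 + stdCDF (0 + d) < 2 - α := by
    have := stdCDF_lt_one (0 + d)
    rw [stdCDF_zero]
    linarith
  have hMd : stdCDF M ≤ stdCDF (M + d) := strictMono_stdCDF.monotone (by linarith)
  obtain ⟨z, hz, hzp⟩ := intermediate_value_Icc hM0.le hcont.continuousOn
    (show 2 - α ∈ Set.Icc (stdCDF 0 + stdCDF (0 + d)) (stdCDF M + stdCDF (M + d)) from
      ⟨h0.le, by linarith⟩)
  refine ⟨z, lt_of_le_of_ne hz.1 ?_, hzp⟩
  rintro rfl
  exact h0.ne hzp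

/-- The symmetric pair is the unique minimizer of the limiting two-sided problem. -/
lemma eq_of_stdCDF_add_ge {c d a b : ℝ} (hd : 0 ≤ d) (ha : 0 < a) (hb : 0 < b)
    (hab : a + b ≤ 2 * c)
    (h1 : stdCDF c + stdCDF (c + d) ≤ stdCDF a + stdCDF (b + d))
    (h2 : stdCDF c + stdCDF (c + d) ≤ stdCDF b + stdCDF (a + d)) : a = c ∧ b = c := by
  have hmono := strictMono_stdCDF
  have hconc : ∀ x y : ℝ, 0 ≤ x → 0 ≤ y → stdCDF x + stdCDF y ≤ 2 * stdCDF ((x + y) / 2) := by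
    intro x y hx hy
    have := strictConcaveOn_stdCDF.concaveOn.2 (Set.mem_Ici.mpr hx) (Set.mem_Ici.mpr hy)
      (show (0 : ℝ) ≤ 1 / 2 by norm_num) (show (0 : ℝ) ≤ 1 / 2 by norm_num) (by norm_num)
    simp only [smul_eq_mul] at this
    rw [show 1 / 2 * x + 1 / 2 * y = (x + y) / 2 by ring] at this
    linarith
  have hm1 : stdCDF ((a + b) / 2) ≤ stdCDF c := hmono.monotone (by linarith)
  have hm2 : stdCDF ((a + d + (b + d)) / 2) ≤ stdCDF (c + d) := hmono.monotone (by linarith)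
  have hc2 := hconc (a + d) (b + d) (by linarith) (by linarith)
  have hab' : a = b := by
    by_contra hne
    have := strictConcaveOn_stdCDF.2 (Set.mem_Ici.mpr ha.le) (Set.mem_Ici.mpr hb.le) hne
      (show (0 : ℝ) < 1 / 2 by norm_num) (show (0 : ℝ) < 1 / 2 by norm_num) (by norm_num)
    simp only [smul_eq_mul] at this
    rw [show 1 / 2 * a + 1 / 2 * b = (a + b) / 2 by ring] at this
    linarith
  subst hab'
  have : c ≤ a := by
    by_contra! hlt
    have := hmono hlt
    have := hmono (show a + d < c + d by linarith)
    linarith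
  constructor <;> linarith

lemma stdPDF_sub_ge {x τ : ℝ} (hx : 0 ≤ x) (hτ : 0 ≤ τ) :
    Real.exp (-τ ^ 2 / 2) * gaussianPDFReal 0 1 x ≤ gaussianPDFReal 0 1 (x - τ) := by
  simp only [stdPDF_eq]
  rw [mul_left_comm, ← Real.exp_add]
  gcongr
  nlinarith [mul_nonneg hx hτ]

lemma stdPDF_add_le {x τ : ℝ} (hx : 0 ≤ x) (hτ : 0 ≤ τ) :
    gaussianPDFReal 0 1 (x + τ) ≤ Real.exp (-τ ^ 2 / 2) * gaussianPDFReal 0 1 x := by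
  simp only [stdPDF_eq]
  rw [mul_left_comm, ← Real.exp_add]
  gcongr
  nlinarith [mul_nonneg hx hτ]

/-- Moving a pair of endpoints outward by more lowers the sum of the distribution functions. -/
lemma stdCDF_shift_le {a₁ a₂ b₁ b₂ τ u : ℝ} (ha : 0 < a₁) (ha' : a₁ ≤ a₂) (hb : b₂ ≤ b₁)
    (hab₁ : a₁ ≤ b₁) (hab₂ : a₂ ≤ b₂) (hτ : 0 ≤ τ) (hu : 0 ≤ u)
    (heq : stdCDF a₁ + stdCDF b₁ = stdCDF a₂ + stdCDF b₂) :
    stdCDF (a₁ - τ - u) + stdCDF (b₁ + τ + u) ≤ stdCDF (a₂ - τ) + stdCDF (b₂ + τ) := by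
  have hstep : stdCDF (a₁ - τ - u) + stdCDF (b₁ + τ + u) ≤
      stdCDF (a₁ - τ) + stdCDF (b₁ + τ) := by
    have hd : ∀ v, HasDerivAt (fun v => stdCDF (a₁ - τ - v) + stdCDF (b₁ + τ + v))
        (gaussianPDFReal 0 1 (a₁ - τ - v) * (-1) + gaussianPDFReal 0 1 (b₁ + τ + v) * 1) v :=
      fun v => ((hasDerivAt_stdCDF _).comp v ((hasDerivAt_id v).const_sub _)).add
        ((hasDerivAt_stdCDF _).comp v ((hasDerivAt_id v).const_add _))
    have hanti : AntitoneOn (fun v => stdCDF (a₁ - τ - v) + stdCDF (b₁ + τ + v))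
        (Set.Ici 0) := by
      refine antitoneOn_of_deriv_nonpos (convex_Ici 0)
        (fun v _ => (hd v).continuousAt.continuousWithinAt)
        (fun v _ => (hd v).differentiableAt.differentiableWithinAt) fun v hv => ?_
      rw [interior_Ici, Set.mem_Ioi] at hv
      rw [(hd v).deriv]
      have : gaussianPDFReal 0 1 (b₁ + τ + v) ≤ gaussianPDFReal 0 1 (a₁ - τ - v) := by
        apply stdPDF_le
        rw [abs_of_pos (show 0 < b₁ + τ + v by linarith), abs_le]
        constructor <;> linarith
      linarith
    simpa using hanti Set.self_mem_Ici hu hu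
  have hleft : Real.exp (-τ ^ 2 / 2) * (stdCDF a₂ - stdCDF a₁) ≤
      stdCDF (a₂ - τ) - stdCDF (a₁ - τ) := by
    have hd : ∀ x, HasDerivAt (fun x => stdCDF (x - τ) - Real.exp (-τ ^ 2 / 2) * stdCDF x)
        (gaussianPDFReal 0 1 (x - τ) * 1 - Real.exp (-τ ^ 2 / 2) * gaussianPDFReal 0 1 x) x :=
      fun x => ((hasDerivAt_stdCDF _).comp x ((hasDerivAt_id x).sub_const _)).sub
        ((hasDerivAt_stdCDF x).const_mul _)
    have hmono : MonotoneOn (fun x => stdCDF (x - τ) - Real.exp (-τ ^ 2 / 2) * stdCDF x)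
        (Set.Ici 0) := by
      refine monotoneOn_of_deriv_nonneg (convex_Ici 0)
        (fun v _ => (hd v).continuousAt.continuousWithinAt)
        (fun v _ => (hd v).differentiableAt.differentiableWithinAt) fun v hv => ?_
      rw [interior_Ici, Set.mem_Ioi] at hv
      rw [(hd v).deriv]
      linarith [stdPDF_sub_ge hv.le hτ]
    have := hmono (Set.mem_Ici.mpr ha.le) (Set.mem_Ici.mpr (ha.le.trans ha')) ha'
    simp only at this
    linarith
  have hright : stdCDF (b₁ + τ) - stdCDF (b₂ + τ) ≤
      Real.exp (-τ ^ 2 / 2) * (stdCDF b₁ - stdCDF b₂) := by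
    have hd : ∀ x, HasDerivAt (fun x => stdCDF (x + τ) - Real.exp (-τ ^ 2 / 2) * stdCDF x)
        (gaussianPDFReal 0 1 (x + τ) * 1 - Real.exp (-τ ^ 2 / 2) * gaussianPDFReal 0 1 x) x :=
      fun x => ((hasDerivAt_stdCDF _).comp x ((hasDerivAt_id x).add_const _)).sub
        ((hasDerivAt_stdCDF x).const_mul _)
    have hanti : AntitoneOn (fun x => stdCDF (x + τ) - Real.exp (-τ ^ 2 / 2) * stdCDF x)
        (Set.Ici 0) := by
      refine antitoneOn_of_deriv_nonpos (convex_Ici 0)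
        (fun v _ => (hd v).continuousAt.continuousWithinAt)
        (fun v _ => (hd v).differentiableAt.differentiableWithinAt) fun v hv => ?_
      rw [interior_Ici, Set.mem_Ioi] at hv
      rw [(hd v).deriv]
      linarith [stdPDF_add_le hv.le hτ]
    have := hanti (Set.mem_Ici.mpr (show 0 ≤ b₂ by linarith))
      (Set.mem_Ici.mpr (show 0 ≤ b₁ by linarith)) hb
    simp only at this
    linarith
  rw [show stdCDF a₂ - stdCDF a₁ = stdCDF b₁ - stdCDF b₂ by linarith] at hleft
  linarith

/-- The limiting coverage of a point outside the identified interval increases with the common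
standard deviation. -/
lemma limit_coverage_mono {σ₁ σ₂ δ t c₁ c₂ : ℝ} (hσ₁ : 0 < σ₁) (hσ : σ₁ ≤ σ₂) (hδ : 0 ≤ δ)
    (ht : 0 ≤ t) (hc₁ : 0 < c₁)
    (heq : stdCDF c₁ + stdCDF (c₁ + δ / σ₁) = stdCDF c₂ + stdCDF (c₂ + δ / σ₂)) :
    stdCDF ((σ₁ * c₁ - t) / σ₁) - stdCDF ((-t - δ - σ₁ * c₁) / σ₁) ≤
      stdCDF ((σ₂ * c₂ - t) / σ₂) - stdCDF ((-t - δ - σ₂ * c₂) / σ₂) := by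
  have hσ₂ : 0 < σ₂ := hσ₁.trans_le hσ
  have hδσ : δ / σ₂ ≤ δ / σ₁ := div_le_div_of_nonneg_left hδ hσ₁ hσ
  have htσ : t / σ₂ ≤ t / σ₁ := div_le_div_of_nonneg_left ht hσ₁ hσ
  have hδ₂ : 0 ≤ δ / σ₂ := by positivity
  have hδ₁ : 0 ≤ δ / σ₁ := by positivity
  have hc : c₁ ≤ c₂ := by
    by_contra! hlt
    have := strictMono_stdCDF hlt
    have := strictMono_stdCDF (show c₂ + δ / σ₂ < c₁ + δ / σ₁ by linarith)
    linarith
  have hcd : c₂ + δ / σ₂ ≤ c₁ + δ / σ₁ := by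
    by_contra! hlt
    have := strictMono_stdCDF hlt
    have := strictMono_stdCDF.monotone hc
    linarith
  have key := stdCDF_shift_le (τ := t / σ₂) (u := t / σ₁ - t / σ₂) hc₁ hc hcd
    (by linarith) (by linarith) (by positivity) (by linarith) heq
  rw [show (σ₁ * c₁ - t) / σ₁ = c₁ - t / σ₂ - (t / σ₁ - t / σ₂) by field_simp; ring,
    show (σ₂ * c₂ - t) / σ₂ = c₂ - t / σ₂ by field_simp,
    show (-t - δ - σ₁ * c₁) / σ₁ = -(c₁ + δ / σ₁ + t / σ₂ + (t / σ₁ - t / σ₂)) by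
      field_simp; ring,
    show (-t - δ - σ₂ * c₂) / σ₂ = -(c₂ + δ / σ₂ + t / σ₂) by field_simp; ring,
    stdCDF_neg, stdCDF_neg]
  linarith

section HighProbability

variable {Ω : ℕ → Type*} [∀ k, MeasurableSpace (Ω k)] (Q : ∀ k, Measure (Ω k))

/-- The filter of events on a sequence of measure spaces whose complements have measure tending
to zero. Convergence in probability is convergence along this filter. -/
def highProb : Filter (Σ k, Ω k) where
  sets := {S | Tendsto (fun k => Q k {ω | (⟨k, ω⟩ : Σ k, Ω k) ∉ S}) atTop (𝓝 0)}
  univ_sets := by simp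
  sets_of_superset {S T} hS hST := by
    refine tendsto_of_tendsto_of_tendsto_of_le_of_le tendsto_const_nhds hS
      (fun _ => zero_le) fun k => measure_mono fun ω hω hωS => hω (hST hωS)
  inter_sets {S T} hS hT := by
    have h := Tendsto.add hS hT
    rw [add_zero] at h
    refine tendsto_of_tendsto_of_tendsto_of_le_of_le tendsto_const_nhds h
      (fun _ => zero_le) fun k => le_trans (measure_mono fun ω hω => ?_) (measure_union_le _ _)
    by_contra hcon
    simp only [Set.mem_union, Set.mem_ofPred_eq, not_or, not_not] at hcon
    exact hω hcon

variable {Q}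

lemma eventually_highProb_iff {P : (Σ k, Ω k) → Prop} :
    (∀ᶠ p in highProb Q, P p) ↔ Tendsto (fun k => Q k {ω | ¬ P ⟨k, ω⟩}) atTop (𝓝 0) := Iff.rfl

lemma eventually_highProb_of_ae {P : (Σ k, Ω k) → Prop} (h : ∀ k, ∀ᵐ ω ∂(Q k), P ⟨k, ω⟩) :
    ∀ᶠ p in highProb Q, P p := by
  rw [eventually_highProb_iff]
  simp only [ae_iff] at h
  simp [h]

lemma tendsto_fst_highProb : Tendsto Sigma.fst (highProb Q) atTop := by
  refine tendsto_atTop.mpr fun a => eventually_highProb_iff.mpr ?_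
  refine tendsto_const_nhds.congr' ?_
  filter_upwards [eventually_ge_atTop a] with k hk
  simp [hk]

variable [∀ k, IsProbabilityMeasure (Q k)]

lemma eventually_measureReal_le {S T : Set (Σ k, Ω k)} (h : ∀ᶠ p in highProb Q, p ∈ S → p ∈ T)
    {ε : ℝ} (hε : 0 < ε) :
    ∀ᶠ k in atTop, (Q k).real (Sigma.mk k ⁻¹' S) ≤ (Q k).real (Sigma.mk k ⁻¹' T) + ε := by
  have h' := (ENNReal.tendsto_toReal ENNReal.zero_ne_top).comp (eventually_highProb_iff.mp h)
  filter_upwards [h'.eventually (gt_mem_nhds (show (0 : ENNReal).toReal < ε by simpa))] with k hk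
  have hsub : Sigma.mk k ⁻¹' S ⊆
      Sigma.mk k ⁻¹' T ∪ {ω | ¬ ((⟨k, ω⟩ : Σ k, Ω k) ∈ S → (⟨k, ω⟩ : Σ k, Ω k) ∈ T)} := by
    intro ω hω
    by_cases hT : (⟨k, ω⟩ : Σ k, Ω k) ∈ T
    · exact Or.inl hT
    · exact Or.inr fun hST => hT (hST hω)
  refine (measureReal_mono hsub).trans ((measureReal_union_le _ _).trans ?_)
  gcongr
  exact hk.le

lemma tendsto_measureReal_of_squeeze {S : Set (Σ k, Ω k)} {q : ℝ}
    (hup : ∀ ε > 0, ∃ T : Set (Σ k, Ω k), ∃ q' < q + ε, (∀ᶠ p in highProb Q, p ∈ S → p ∈ T) ∧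
      Tendsto (fun k => (Q k).real (Sigma.mk k ⁻¹' T)) atTop (𝓝 q'))
    (hlo : ∀ ε > 0, ∃ T : Set (Σ k, Ω k), ∃ q' > q - ε, (∀ᶠ p in highProb Q, p ∈ T → p ∈ S) ∧
      ∀ᶠ k in atTop, q' ≤ (Q k).real (Sigma.mk k ⁻¹' T)) :
    Tendsto (fun k => (Q k).real (Sigma.mk k ⁻¹' S)) atTop (𝓝 q) := by
  rw [tendsto_order]
  constructor
  · intro a ha
    obtain ⟨T, q', hq', hT, hlim⟩ := hlo ((q - a) / 2) (by linarith)
    filter_upwards [eventually_measureReal_le hT (show 0 < (q - a) / 2 by linarith), hlim]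
      with k h1 h2
    linarith
  · intro a ha
    obtain ⟨T, q', hq', hT, hlim⟩ := hup ((a - q) / 2) (by linarith)
    filter_upwards [eventually_measureReal_le hT (show 0 < (a - q) / 4 by linarith),
      hlim.eventually (gt_mem_nhds (show q' < q' + (a - q) / 4 by linarith))] with k h1 h2
    linarith

lemma exists_pos_lt_of_continuousAt {f : ℝ → ℝ} (hf : ContinuousAt f 0) {ε : ℝ} (hε : 0 < ε) :
    ∃ η > 0, |f η - f 0| < ε := by
  have h := (hf.tendsto.mono_left (nhdsWithin_le_nhds (s := Set.Ioi 0))).eventually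
    (Metric.ball_mem_nhds _ hε)
  obtain ⟨η, h1, h2⟩ := (h.and self_mem_nhdsWithin).exists
  exact ⟨η, h2, h1⟩

variable {X V W : (Σ k, Ω k) → ℝ} {G : ℝ → ℝ} {v w : ℝ} {S : Set (Σ k, Ω k)}

/-- Slutsky: a random threshold converging in probability may be replaced by its limit. -/
lemma tendsto_measureReal_le_random (hG : Continuous G)
    (hcdf : ∀ x, Tendsto (fun k => (Q k).real {ω | X ⟨k, ω⟩ ≤ x}) atTop (𝓝 (G x)))
    (hW : Tendsto W (highProb Q) (𝓝 w))
    (hS : ∀ᶠ p in highProb Q, p ∈ S ↔ X p ≤ W p) :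
    Tendsto (fun k => (Q k).real (Sigma.mk k ⁻¹' S)) atTop (𝓝 (G w)) := by
  refine tendsto_measureReal_of_squeeze (fun ε hε => ?_) fun ε hε => ?_
  · obtain ⟨η, hη, hηε⟩ := exists_pos_lt_of_continuousAt
      (f := fun η => G (w + η)) (by fun_prop) hε
    simp only [add_zero, abs_lt] at hηε
    refine ⟨{p | X p ≤ w + η}, G (w + η), by linarith, ?_, hcdf _⟩
    filter_upwards [hS, hW.eventually (gt_mem_nhds (show w < w + η by linarith))] with p h1 h2 h3
    exact (h1.mp h3).trans h2.le
  · obtain ⟨η, hη, hηε⟩ := exists_pos_lt_of_continuousAt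
      (f := fun η => G (w - η)) (by fun_prop) (half_pos hε)
    simp only [sub_zero, abs_lt] at hηε
    refine ⟨{p | X p ≤ w - η}, G (w - η) - ε / 2, by linarith, ?_, ?_⟩
    · filter_upwards [hS, hW.eventually (lt_mem_nhds (show w - η < w by linarith))]
        with p h1 h2 h3
      exact h1.mpr (le_trans h3 h2.le)
    · exact ((hcdf _).eventually (lt_mem_nhds
        (show G (w - η) - ε / 2 < G (w - η) by linarith))).mono fun _ => le_of_lt

/-- Slutsky for an interval with random endpoints converging in probability. -/
lemma tendsto_measureReal_between_random (hG : Continuous G)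
    (hX : ∀ k, Measurable fun ω => X ⟨k, ω⟩)
    (hcdf : ∀ x, Tendsto (fun k => (Q k).real {ω | X ⟨k, ω⟩ ≤ x}) atTop (𝓝 (G x)))
    (hV : Tendsto V (highProb Q) (𝓝 v)) (hW : Tendsto W (highProb Q) (𝓝 w)) (hvw : v ≤ w)
    (hS : ∀ᶠ p in highProb Q, p ∈ S ↔ V p ≤ X p ∧ X p ≤ W p) :
    Tendsto (fun k => (Q k).real (Sigma.mk k ⁻¹' S)) atTop (𝓝 (G w - G v)) := by
  refine tendsto_measureReal_of_squeeze (fun ε hε => ?_) fun ε hε => ?_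
  · obtain ⟨η, hη, hηε⟩ := exists_pos_lt_of_continuousAt
      (f := fun η => G (w + η) - G (v - η)) (by fun_prop) hε
    simp only [add_zero, sub_zero, abs_lt] at hηε
    refine ⟨{p | X p ≤ w + η} \ {p | X p ≤ v - η}, G (w + η) - G (v - η), by linarith, ?_, ?_⟩
    · filter_upwards [hS, hW.eventually (gt_mem_nhds (show w < w + η by linarith)),
        hV.eventually (lt_mem_nhds (show v - η < v by linarith))] with p h1 h2 h3 h4
      exact ⟨(h1.mp h4).2.trans h2.le, not_le.mpr (h3.trans_le (h1.mp h4).1)⟩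
    · refine ((hcdf (w + η)).sub (hcdf (v - η))).congr fun k => ?_
      exact (measureReal_sdiff (fun ω (hω : _ ≤ _) => hω.trans (by linarith))
        (measurableSet_le (hX k) measurable_const)).symm
  · obtain ⟨η, hη, hηε⟩ := exists_pos_lt_of_continuousAt
      (f := fun η => G (w - η) - G (v + η)) (by fun_prop) (half_pos hε)
    simp only [add_zero, sub_zero, abs_lt] at hηε
    refine ⟨{p | X p ≤ w - η} \ {p | X p ≤ v + η}, G (w - η) - G (v + η) - ε / 2,
      by linarith, ?_, ?_⟩
    · filter_upwards [hS, hW.eventually (lt_mem_nhds (show w - η < w by linarith)),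
        hV.eventually (gt_mem_nhds (show v < v + η by linarith))] with p h1 h2 h3 h4
      exact h1.mpr ⟨h3.le.trans (not_le.mp h4.2).le, le_trans h4.1 h2.le⟩
    · filter_upwards [((hcdf (w - η)).sub (hcdf (v + η))).eventually (lt_mem_nhds
        (show G (w - η) - G (v + η) - ε / 2 < G (w - η) - G (v + η) by linarith))] with k hk
      exact hk.le.trans (le_measureReal_sdiff)

/-- A threshold tending to `-∞` in probability is met with vanishing probability. -/
lemma tendsto_measureReal_le_atBot (hG : Tendsto G atBot (𝓝 0))
    (hcdf : ∀ x, Tendsto (fun k => (Q k).real {ω | X ⟨k, ω⟩ ≤ x}) atTop (𝓝 (G x)))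
    (hW : Tendsto W (highProb Q) atBot)
    (hS : ∀ᶠ p in highProb Q, p ∈ S → X p ≤ W p) :
    Tendsto (fun k => (Q k).real (Sigma.mk k ⁻¹' S)) atTop (𝓝 0) := by
  refine tendsto_measureReal_of_squeeze (fun ε hε => ?_) fun ε hε =>
    ⟨∅, 0, by linarith, by simp, by simp⟩
  obtain ⟨x, hx⟩ := (hG.eventually (gt_mem_nhds hε)).exists
  refine ⟨{p | X p ≤ x}, G x, by linarith, ?_, hcdf _⟩
  filter_upwards [hS, hW.eventually (eventually_le_atBot x)] with p h1 h2 h3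
  exact (h1 h3).trans h2

/-- A sequence tight below plus a diverging drift diverges in probability. -/
lemma tendsto_add_atTop_of_cdf {d : ℕ → ℝ} (hG : Tendsto G atBot (𝓝 0))
    (hcdf : ∀ x, Tendsto (fun k => (Q k).real {ω | X ⟨k, ω⟩ ≤ x}) atTop (𝓝 (G x)))
    (hd : Tendsto d atTop atTop) :
    Tendsto (fun p => X p + d p.1) (highProb Q) atTop := by
  refine tendsto_atTop.mpr fun M => eventually_highProb_iff.mpr ?_
  have h := tendsto_measureReal_le_atBot (S := {p | ¬ M ≤ X p + d p.1})
    (W := fun p => M + -d p.1) hG hcdf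
    (tendsto_atBot_add_const_left _ M ((tendsto_neg_atTop_atBot.comp hd).comp
      tendsto_fst_highProb)) (Eventually.of_forall fun p hp => by
        simp only [Set.mem_ofPred_eq, not_le] at hp
        linarith)
  refine (ENNReal.tendsto_toReal_iff (fun k => measure_ne_top _ _) ENNReal.zero_ne_top).mp ?_
  simpa [measureReal_def] using h

end HighProbability

section WeakConvergence

variable {Ω : ℕ → Type*} [∀ k, MeasurableSpace (Ω k)] {Q : ∀ k, Measure (Ω k)}
  [∀ k, IsProbabilityMeasure (Q k)] {E : Type*} [TopologicalSpace E]
  [MeasurableSpace E] [BorelSpace E] {μ : Measure E} [IsProbabilityMeasure μ]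
  {Z : (Σ k, Ω k) → E}

lemma tendsto_map_of_forall_integral (hZ : ∀ k, Measurable fun ω => Z ⟨k, ω⟩)
    (h : ∀ g : BoundedContinuousFunction E ℝ,
      Tendsto (fun k => ∫ ω, g (Z ⟨k, ω⟩) ∂(Q k)) atTop (𝓝 (∫ x, g x ∂μ))) :
    Tendsto (β := ProbabilityMeasure E) (fun k => (⟨(Q k).map fun ω => Z ⟨k, ω⟩,
      Measure.isProbabilityMeasure_map (hZ k).aemeasurable⟩)) atTop
      (𝓝 ⟨μ, inferInstance⟩) := by
  refine ProbabilityMeasure.tendsto_iff_forall_integral_tendsto.mpr fun g => ?_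
  refine (h g).congr fun k => ?_
  exact (integral_map (hZ k).aemeasurable
    g.continuous.measurable.aestronglyMeasurable).symm

variable [HasOuterApproxClosed E]

lemma eventually_notMem_of_isClosed (hZ : ∀ k, Measurable fun ω => Z ⟨k, ω⟩)
    (h : ∀ g : BoundedContinuousFunction E ℝ,
      Tendsto (fun k => ∫ ω, g (Z ⟨k, ω⟩) ∂(Q k)) atTop (𝓝 (∫ x, g x ∂μ)))
    {C : Set E} (hC : IsClosed C) (hμC : μ C = 0) : ∀ᶠ p in highProb Q, Z p ∉ C := by
  have h1 := ProbabilityMeasure.limsup_measure_closed_le_of_tendsto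
    (tendsto_map_of_forall_integral hZ h) hC
  simp only [ProbabilityMeasure.coe_mk, hμC] at h1
  rw [eventually_highProb_iff]
  refine tendsto_of_le_liminf_of_limsup_le bot_le (le_trans (le_of_eq ?_) h1)
  congr 1
  ext k
  rw [Measure.map_apply (hZ k) hC.measurableSet]
  simp [Set.preimage]

lemma measure_eq_zero_of_eventually_notMem (hZ : ∀ k, Measurable fun ω => Z ⟨k, ω⟩)
    (h : ∀ g : BoundedContinuousFunction E ℝ,
      Tendsto (fun k => ∫ ω, g (Z ⟨k, ω⟩) ∂(Q k)) atTop (𝓝 (∫ x, g x ∂μ)))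
    {O : Set E} (hO : IsOpen O) (hev : ∀ᶠ p in highProb Q, Z p ∉ O) : μ O = 0 := by
  have h1 := ProbabilityMeasure.le_liminf_measure_open_of_tendsto
    (tendsto_map_of_forall_integral hZ h) hO
  have h2 := (eventually_highProb_iff.mp hev).liminf_eq
  refine le_antisymm (h1.trans (le_trans (le_of_eq ?_) h2.le)) zero_le
  congr 1
  ext k
  simp only [ProbabilityMeasure.coe_mk]
  rw [Measure.map_apply (hZ k) hO.measurableSet]
  simp [Set.preimage]

lemma tendsto_measureReal_le_of_null (hZ : ∀ k, Measurable fun ω => Z ⟨k, ω⟩)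
    (h : ∀ g : BoundedContinuousFunction E ℝ,
      Tendsto (fun k => ∫ ω, g (Z ⟨k, ω⟩) ∂(Q k)) atTop (𝓝 (∫ x, g x ∂μ)))
    {f : E → ℝ} (hf : Continuous f) {x : ℝ} (hx : μ {z | f z = x} = 0) :
    Tendsto (fun k => (Q k).real {ω | f (Z ⟨k, ω⟩) ≤ x}) atTop (𝓝 (μ.real {z | f z ≤ x})) := by
  have h1 := ProbabilityMeasure.tendsto_measure_of_null_frontier_of_tendsto'
    (tendsto_map_of_forall_integral hZ h) (E := {z | f z ≤ x})
    (measure_mono_null (frontier_le_subset_eq hf continuous_const) hx)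
  have h2 := (ENNReal.tendsto_toReal (measure_ne_top μ _)).comp h1
  refine h2.congr fun k => ?_
  simp only [Function.comp, ProbabilityMeasure.coe_mk]
  rw [Measure.map_apply (hZ k) (measurableSet_le hf.measurable measurable_const)]
  rfl

end WeakConvergence

section GaussianPair

instance isProbabilityMeasure_stdPair : IsProbabilityMeasure stdPair := by
  unfold stdPair; infer_instance

lemma map_fst_stdPair : stdPair.map Prod.fst = gaussianReal 0 1 := by
  simp [stdPair, Measure.map_fst_prod]

lemma map_neg_stdPair : stdPair.map (fun z => -z) = stdPair := by
  have h : (gaussianReal 0 1).map (fun y => -y) = gaussianReal 0 1 := by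
    simp [gaussianReal_map_neg]
  have := Measure.map_prod_map (gaussianReal 0 1) (gaussianReal 0 1)
    (measurable_neg (G := ℝ)) (measurable_neg (G := ℝ))
  rw [h] at this
  exact this.symm

/-- A unit-variance linear combination of two independent standard normals is standard normal. -/
lemma map_linear_stdPair {a b : ℝ} (hab : a ^ 2 + b ^ 2 = 1) :
    stdPair.map (fun z => a * z.1 + b * z.2) = gaussianReal 0 1 := by
  have hind : IndepFun (fun z : ℝ × ℝ => a * z.1) (fun z : ℝ × ℝ => b * z.2) stdPair :=
    indepFun_prod (measurable_const_mul a) (measurable_const_mul b)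
  have hX : stdPair.map (fun z : ℝ × ℝ => a * z.1) = (gaussianReal 0 1).map (a * ·) := by
    rw [← map_fst_stdPair, Measure.map_map (measurable_const_mul a) measurable_fst]
    rfl
  have hY : stdPair.map (fun z : ℝ × ℝ => b * z.2) = (gaussianReal 0 1).map (b * ·) := by
    rw [show gaussianReal 0 1 = stdPair.map Prod.snd by simp [stdPair, Measure.map_snd_prod],
      Measure.map_map (measurable_const_mul b) measurable_snd]
    rfl
  rw [gaussianReal_map_const_mul] at hX hY
  refine (gaussianReal_add_gaussianReal_of_indepFun hind hX hY).trans ?_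
  congr 1
  · simp
  · ext
    simpa using hab

lemma measure_linear_eq_stdPair {a b σ : ℝ} (hσ : 0 < σ) (hab : a ^ 2 + b ^ 2 = σ ^ 2) (x : ℝ) :
    stdPair {z | a * z.1 + b * z.2 = x} = 0 := by
  have h := map_linear_stdPair (a := a / σ) (b := b / σ) (by field_simp; exact hab)
  have h0 : gaussianReal 0 1 {x / σ} = 0 := measure_singleton _
  rw [← h, Measure.map_apply (by fun_prop) (measurableSet_singleton _)] at h0
  convert! h0 using 2
  ext z
  simp only [Set.mem_ofPred_eq, Set.mem_preimage, Set.mem_singleton_iff]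
  field_simp

lemma measureReal_linear_le_stdPair {a b σ : ℝ} (hσ : 0 < σ) (hab : a ^ 2 + b ^ 2 = σ ^ 2)
    (x : ℝ) : stdPair.real {z | a * z.1 + b * z.2 ≤ x} = stdCDF (x / σ) := by
  have h := map_linear_stdPair (a := a / σ) (b := b / σ) (by field_simp; exact hab)
  rw [stdCDF, ← h, map_measureReal_apply (by fun_prop) measurableSet_Iic]
  congr 1
  ext z
  simp only [Set.mem_ofPred_eq, Set.mem_preimage, Set.mem_Iic]
  rw [div_mul_eq_mul_div, div_mul_eq_mul_div, ← add_div, div_le_div_iff_of_pos_right hσ]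

lemma measure_fst_eq_stdPair (x : ℝ) : stdPair {z | z.1 = x} = 0 := by
  simpa using measure_linear_eq_stdPair (a := 1) (b := 0) one_pos (by norm_num) x

lemma isOpenPosMeasure_stdPair : stdPair.IsOpenPosMeasure := by
  have : (gaussianReal 0 1).IsOpenPosMeasure :=
    (gaussianReal_absolutelyContinuous' 0 one_ne_zero).isOpenPosMeasure
  unfold stdPair
  infer_instance

lemma measureReal_stdPair_fst_ge (x : ℝ) : stdPair.real {z | -x ≤ z.1} = stdCDF x := by
  rw [stdCDF_eq_measureReal_Ici, ← map_fst_stdPair,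
    map_measureReal_apply measurable_fst measurableSet_Ici]
  rfl

lemma measureReal_stdPair_fst_between {x y : ℝ} (hxy : -x ≤ y) :
    stdPair.real {z | -x ≤ z.1 ∧ z.1 ≤ y} = stdCDF x + stdCDF y - 1 := by
  have hs : {z : ℝ × ℝ | -x ≤ z.1 ∧ z.1 ≤ y} = {z | -x ≤ z.1} \ {z | -(-y) < z.1} := by
    ext z
    simp
  have hnull : stdPair.real {z | -(-y) < z.1} = stdCDF (-y) := by
    rw [← measureReal_stdPair_fst_ge]
    refine measureReal_congr ?_
    filter_upwards [measure_eq_zero_iff_ae_notMem.mp (measure_fst_eq_stdPair (-(-y)))] with z hz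
    exact propext ⟨le_of_lt, fun h => lt_of_le_of_ne h (Ne.symm hz)⟩
  have hsub : {z : ℝ × ℝ | -(-y) < z.1} ⊆ {z | -x ≤ z.1} := fun z (hz : -(-y) < z.1) =>
    (hxy.trans_eq (neg_neg y).symm).trans hz.le
  rw [hs, measureReal_sdiff hsub (measurableSet_lt measurable_const measurable_fst),
    measureReal_stdPair_fst_ge, hnull, stdCDF_neg]
  ring

end GaussianPair

section Solution

/-- The probability in the constraints of Stoye's problem. -/
noncomputable def feasProb (r x y : ℝ) : ℝ :=
  stdPair.real {z | -x ≤ z.1 ∧ r * z.1 ≤ y + Real.sqrt (1 - r ^ 2) * z.2}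

lemma measurableSet_feasProb (r x y : ℝ) :
    MeasurableSet {z : ℝ × ℝ | -x ≤ z.1 ∧ r * z.1 ≤ y + Real.sqrt (1 - r ^ 2) * z.2} :=
  (measurableSet_le (f := fun _ : ℝ × ℝ => -x) (g := fun z => z.1) (by fun_prop)
    (by fun_prop)).inter (measurableSet_le (f := fun z : ℝ × ℝ => r * z.1)
      (g := fun z => y + Real.sqrt (1 - r ^ 2) * z.2) (by fun_prop) (by fun_prop))

/-- Pointwise almost sure convergence of events implies convergence of their probabilities. -/
lemma tendsto_measureReal_of_ae_eventually_iff {ι E : Type*} [MeasurableSpace E] {μ : Measure E}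
    [IsFiniteMeasure μ] {F : Filter ι} [F.IsCountablyGenerated] {A : ι → Set E} {B : Set E}
    (hA : ∀ i, MeasurableSet (A i)) (hB : MeasurableSet B)
    (h : ∀ᵐ z ∂μ, ∀ᶠ i in F, z ∈ A i ↔ z ∈ B) :
    Tendsto (fun i => μ.real (A i)) F (𝓝 (μ.real B)) :=
  (ENNReal.tendsto_toReal (measure_ne_top _ _)).comp
    (tendsto_measure_of_ae_tendsto_indicator_of_isFiniteMeasure F hB hA h)

lemma ci2Feasible_iff {α r du dl cl cu : ℝ} : CI2Feasible α r du dl cl cu ↔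
    1 - α ≤ feasProb r cl (cu + du) ∧ 1 - α ≤ feasProb r cu (cl + dl) := by
  refine and_congr Iff.rfl ?_
  conv_rhs => rw [feasProb, ← map_neg_stdPair,
    map_measureReal_apply measurable_neg (measurableSet_feasProb _ _ _)]
  rw [← measureReal_def]
  convert! Iff.rfl using 3
  ext z
  simp only [Set.mem_preimage, Set.mem_ofPred_eq, Prod.fst_neg, Prod.snd_neg]
  constructor
  · rintro ⟨h1, h2⟩
    constructor <;> linarith
  · rintro ⟨h1, h2⟩
    constructor <;> linarith

lemma feasProb_le (r x y : ℝ) : feasProb r x y ≤ stdCDF x := by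
  rw [← measureReal_stdPair_fst_ge]
  exact measureReal_mono fun z hz => hz.1

variable {ι : Type*} {F : Filter ι} {R D Sl Su cl cu x y : ι → ℝ}

lemma tendsto_feasProb_one {a b : ℝ} (hab : -a ≤ b) (hR : Tendsto R F (𝓝 1))
    (hx : Tendsto x F (𝓝 a)) (hy : Tendsto y F (𝓝 b)) :
    Tendsto (fun i => feasProb (R i) (x i) (y i)) F (𝓝 (stdCDF a + stdCDF b - 1)) := by
  have key : Tendsto (fun q : ℝ × ℝ × ℝ => feasProb q.1 q.2.1 q.2.2) (𝓝 (1, a, b))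
      (𝓝 (stdCDF a + stdCDF b - 1)) := by
    rw [← measureReal_stdPair_fst_between hab]
    have hB : MeasurableSet {z : ℝ × ℝ | -a ≤ z.1 ∧ z.1 ≤ b} :=
      (measurableSet_le (f := fun _ : ℝ × ℝ => -a) (g := fun z => z.1) (by fun_prop)
        (by fun_prop)).inter (measurableSet_le (f := fun z : ℝ × ℝ => z.1) (g := fun _ => b)
          (by fun_prop) (by fun_prop))
    refine tendsto_measureReal_of_ae_eventually_iff
      (fun q : ℝ × ℝ × ℝ => measurableSet_feasProb q.1 q.2.1 q.2.2) hB ?_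
    filter_upwards [measure_eq_zero_iff_ae_notMem.mp (measure_fst_eq_stdPair (-a)),
      measure_eq_zero_iff_ae_notMem.mp (measure_fst_eq_stdPair b)] with z hz1 hz2
    have hc1 : Tendsto (fun q : ℝ × ℝ × ℝ => z.1 + q.2.1) (𝓝 (1, a, b)) (𝓝 (z.1 + a)) :=
      Continuous.tendsto (by fun_prop) (1, a, b)
    have hc2 : Tendsto (fun q : ℝ × ℝ × ℝ => q.2.2 + Real.sqrt (1 - q.1 ^ 2) * z.2 - q.1 * z.1)
        (𝓝 (1, a, b)) (𝓝 (b - z.1)) := by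
      have := Continuous.tendsto (f := fun q : ℝ × ℝ × ℝ =>
        q.2.2 + Real.sqrt (1 - q.1 ^ 2) * z.2 - q.1 * z.1) (by fun_prop) (1, a, b)
      simpa using this
    have e1 : ∀ᶠ q : ℝ × ℝ × ℝ in 𝓝 (1, a, b), (-q.2.1 ≤ z.1 ↔ -a ≤ z.1) := by
      rcases lt_or_gt_of_ne hz1 with h | h
      · filter_upwards [hc1.eventually (gt_mem_nhds (show z.1 + a < 0 by linarith))] with q hq
        constructor <;> intro _ <;> linarith
      · filter_upwards [hc1.eventually (lt_mem_nhds (show 0 < z.1 + a by linarith))] with q hq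
        constructor <;> intro _ <;> linarith
    have e2 : ∀ᶠ q : ℝ × ℝ × ℝ in 𝓝 (1, a, b),
        (q.1 * z.1 ≤ q.2.2 + Real.sqrt (1 - q.1 ^ 2) * z.2 ↔ z.1 ≤ b) := by
      rcases lt_or_gt_of_ne hz2 with h | h
      · filter_upwards [hc2.eventually (lt_mem_nhds (show 0 < b - z.1 by linarith))] with q hq
        constructor <;> intro _ <;> linarith
      · filter_upwards [hc2.eventually (gt_mem_nhds (show b - z.1 < 0 by linarith))] with q hq
        constructor <;> intro _ <;> linarith
    filter_upwards [e1, e2] with q h1 h2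
    exact and_congr h1 h2
  exact Tendsto.comp (f := fun i => (R i, x i, y i)) key (hR.prodMk_nhds (hx.prodMk_nhds hy))

lemma tendsto_feasProb_atTop {r a : ℝ} (hR : Tendsto R F (𝓝 r)) (hy : Tendsto y F atTop) :
    Tendsto (fun i => feasProb (R i) a (y i)) F (𝓝 (stdCDF a)) := by
  have key : Tendsto (fun q : ℝ × ℝ => feasProb q.1 a q.2) (𝓝 r ×ˢ atTop)
      (𝓝 (stdCDF a)) := by
    rw [← measureReal_stdPair_fst_ge a]
    refine tendsto_measureReal_of_ae_eventually_iff
      (fun q : ℝ × ℝ => measurableSet_feasProb q.1 a q.2)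
      (measurableSet_le measurable_const measurable_fst) (ae_of_all _ fun z => ?_)
    have hc : Tendsto (fun q : ℝ × ℝ => q.1 * z.1 - Real.sqrt (1 - q.1 ^ 2) * z.2)
        (𝓝 r ×ˢ atTop) (𝓝 (r * z.1 - Real.sqrt (1 - r ^ 2) * z.2)) :=
      (Continuous.tendsto (f := fun s : ℝ => s * z.1 - Real.sqrt (1 - s ^ 2) * z.2)
        (by fun_prop) r).comp tendsto_fst
    filter_upwards [hc.eventually (gt_mem_nhds (lt_add_one _)),
      tendsto_snd.eventually (eventually_ge_atTop
        (r * z.1 - Real.sqrt (1 - r ^ 2) * z.2 + 1))] with q h1 h2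
    exact and_iff_left (by linarith)
  exact Tendsto.comp (f := fun i => (R i, y i)) key (hR.prodMk hy)

/-- Convergence of minimizers when the limit problem has a unique solution on the diagonal. -/
lemma tendsto_of_unique_minimizer {sl su c z : ℝ} (hsl : 0 < sl) (hsu : 0 < su)
    (hSl : Tendsto Sl F (𝓝 sl)) (hSu : Tendsto Su F (𝓝 su))
    (hz : ∀ᶠ i in F, z ≤ cl i ∧ z ≤ cu i)
    (hobj : ∀ η > 0, ∀ᶠ i in F, Sl i * cl i + Su i * cu i ≤ Sl i * (c + η) + Su i * (c + η))
    (huniq : ∀ G : Filter ι, G ≤ F → G.NeBot → ∀ a b, Tendsto cl G (𝓝 a) → Tendsto cu G (𝓝 b) →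
      z ≤ a → z ≤ b → sl * a + su * b ≤ sl * c + su * c → a = c ∧ b = c) :
    Tendsto cl F (𝓝 c) ∧ Tendsto cu F (𝓝 c) := by
  have hbound : ∃ M, ∀ᶠ i in F, cl i ≤ M ∧ cu i ≤ M := by
    have hlim : Tendsto (fun i => (Sl i * (c + 1) + Su i * (c + 1) - Su i * z) / Sl i) F
        (𝓝 ((sl * (c + 1) + su * (c + 1) - su * z) / sl)) :=
      (((hSl.mul_const _).add (hSu.mul_const _)).sub (hSu.mul_const _)).div hSl hsl.ne'
    have hlim' : Tendsto (fun i => (Sl i * (c + 1) + Su i * (c + 1) - Sl i * z) / Su i) F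
        (𝓝 ((sl * (c + 1) + su * (c + 1) - sl * z) / su)) :=
      (((hSl.mul_const _).add (hSu.mul_const _)).sub (hSl.mul_const _)).div hSu hsu.ne'
    refine ⟨max ((sl * (c + 1) + su * (c + 1) - su * z) / sl + 1)
      ((sl * (c + 1) + su * (c + 1) - sl * z) / su + 1), ?_⟩
    filter_upwards [hlim.eventually (gt_mem_nhds (lt_add_one _)),
      hlim'.eventually (gt_mem_nhds (lt_add_one _)), hz, hobj 1 one_pos,
      hSl.eventually (lt_mem_nhds hsl), hSu.eventually (lt_mem_nhds hsu)]
      with i h1 h2 h3 h4 h5 h6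
    refine ⟨le_trans ?_ (le_max_of_le_left h1.le), le_trans ?_ (le_max_of_le_right h2.le)⟩
    · rw [le_div_iff₀ h5]
      nlinarith [mul_le_mul_of_nonneg_left h3.2 h6.le]
    · rw [le_div_iff₀ h6]
      nlinarith [mul_le_mul_of_nonneg_left h3.1 h5.le]
  obtain ⟨M, hM⟩ := hbound
  have key : ∀ U : Ultrafilter ι, (U : Filter ι) ≤ F →
      Tendsto cl U (𝓝 c) ∧ Tendsto cu U (𝓝 c) := by
    intro U hU
    have hcl : ∀ᶠ i in (U : Filter ι), cl i ∈ Set.Icc z M :=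
      hU (by filter_upwards [hz, hM] with i h1 h2 using ⟨h1.1, h2.1⟩)
    have hcu : ∀ᶠ i in (U : Filter ι), cu i ∈ Set.Icc z M :=
      hU (by filter_upwards [hz, hM] with i h1 h2 using ⟨h1.2, h2.2⟩)
    obtain ⟨a, ha, hla⟩ := isCompact_Icc.ultrafilter_le_nhds (U.map cl)
      (le_principal_iff.mpr hcl)
    obtain ⟨b, hb, hlb⟩ := isCompact_Icc.ultrafilter_le_nhds (U.map cu)
      (le_principal_iff.mpr hcu)
    have hab : sl * a + su * b ≤ sl * c + su * c := by
      have hη : ∀ η > 0, sl * a + su * b ≤ sl * (c + η) + su * (c + η) := fun η hη =>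
        le_of_tendsto_of_tendsto (((hSl.mono_left hU).mul hla).add ((hSu.mono_left hU).mul hlb))
          (((hSl.mono_left hU).mul_const _).add ((hSu.mono_left hU).mul_const _))
          (hU (hobj η hη))
      have hcont : Tendsto (fun η : ℝ => sl * (c + η) + su * (c + η)) (𝓝[>] 0)
          (𝓝 (sl * (c + 0) + su * (c + 0))) :=
        (Continuous.tendsto (by fun_prop) 0).mono_left nhdsWithin_le_nhds
      rw [add_zero] at hcont
      exact ge_of_tendsto hcont (eventually_mem_nhdsWithin.mono hη)
    obtain ⟨rfl, rfl⟩ := huniq U hU U.neBot a b hla hlb ha.1 hb.1 hab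
    exact ⟨hla, hlb⟩
  exact ⟨(tendsto_iff_ultrafilter _ _ _).mpr fun U hU => (key U hU).1,
    (tendsto_iff_ultrafilter _ _ _).mpr fun U hU => (key U hU).2⟩

variable {α : ℝ}

lemma le_of_ci2Feasible {r du dl x y z : ℝ} (hz : stdCDF z = 1 - α)
    (h : CI2Feasible α r du dl x y) : z ≤ x ∧ z ≤ y := by
  obtain ⟨h1, h2⟩ := ci2Feasible_iff.mp h
  exact ⟨strictMono_stdCDF.le_iff_le.mp (hz.le.trans (h1.trans (feasProb_le _ _ _))),
    strictMono_stdCDF.le_iff_le.mp (hz.le.trans (h2.trans (feasProb_le _ _ _)))⟩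

/-- With diverging width, the critical values converge to the one-sided normal quantile. -/
lemma tendsto_solution_wide {r sl su z : ℝ} (hsl : 0 < sl) (hsu : 0 < su)
    (hz : stdCDF z = 1 - α) (hR : Tendsto R F (𝓝 r)) (hSl : Tendsto Sl F (𝓝 sl))
    (hSu : Tendsto Su F (𝓝 su)) (hD : Tendsto D F atTop)
    (hC : ∀ᶠ i in F, CI2Feasible α (R i) (D i / Su i) (D i / Sl i) (cl i) (cu i) ∧
      ∀ x y, CI2Feasible α (R i) (D i / Su i) (D i / Sl i) x y →
        Sl i * cl i + Su i * cu i ≤ Sl i * x + Su i * y) :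
    Tendsto cl F (𝓝 z) ∧ Tendsto cu F (𝓝 z) := by
  refine tendsto_of_unique_minimizer hsl hsu hSl hSu (z := z)
    (hC.mono fun i hi => le_of_ci2Feasible hz hi.1) (fun η hη => ?_) ?_
  · have hlt : 1 - α < stdCDF (z + η) := hz ▸ strictMono_stdCDF (by linarith)
    have h1 := tendsto_feasProb_atTop (a := z + η) hR
      (tendsto_atTop_add_const_left _ (z + η) (hD.atTop_mul_pos (inv_pos.mpr hsu)
        (hSu.inv₀ hsu.ne')))
    have h2 := tendsto_feasProb_atTop (a := z + η) hR
      (tendsto_atTop_add_const_left _ (z + η) (hD.atTop_mul_pos (inv_pos.mpr hsl)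
        (hSl.inv₀ hsl.ne')))
    filter_upwards [hC, h1.eventually (lt_mem_nhds hlt), h2.eventually (lt_mem_nhds hlt)]
      with i hi e1 e2
    exact hi.2 _ _ (ci2Feasible_iff.mpr ⟨e1.le, e2.le⟩)
  · intro G _ _ a b _ _ ha hb hab
    constructor <;> nlinarith

/-- With bounded width and perfect correlation, the critical values converge to the solution of
`Φ(c) + Φ(c + δ / σ) = 2 - α`. -/
lemma tendsto_solution_narrow {σ δ c : ℝ} (hα : 0 < α) (hα' : α < 1 / 2) (hσ : 0 < σ)
    (hδ : 0 ≤ δ) (hc0 : 0 < c)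
    (hc : stdCDF c + stdCDF (c + δ / σ) = 2 - α) (hR : Tendsto R F (𝓝 1))
    (hSl : Tendsto Sl F (𝓝 σ)) (hSu : Tendsto Su F (𝓝 σ)) (hD : Tendsto D F (𝓝 δ))
    (hC : ∀ᶠ i in F, CI2Feasible α (R i) (D i / Su i) (D i / Sl i) (cl i) (cu i) ∧
      ∀ x y, CI2Feasible α (R i) (D i / Su i) (D i / Sl i) x y →
        Sl i * cl i + Su i * cu i ≤ Sl i * x + Su i * y) :
    Tendsto cl F (𝓝 c) ∧ Tendsto cu F (𝓝 c) := by
  obtain ⟨z, hz0, hz⟩ := exists_stdCDF_eq (p := 1 - α) (by linarith) (by linarith)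
  have hd : 0 ≤ δ / σ := by positivity
  refine tendsto_of_unique_minimizer hσ hσ hSl hSu (z := z)
    (hC.mono fun i hi => le_of_ci2Feasible hz hi.1) (fun η hη => ?_) ?_
  · have hlt : 1 - α < stdCDF (c + η) + stdCDF (c + η + δ / σ) - 1 := by
      have h1 := strictMono_stdCDF (show c < c + η by linarith)
      have h2 := strictMono_stdCDF (show c + δ / σ < c + η + δ / σ by linarith)
      linarith
    have h1 := tendsto_feasProb_one (show -(c + η) ≤ c + η + δ / σ by linarith) hR
      tendsto_const_nhds ((hD.div hSu hσ.ne').const_add (c + η))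
    have h2 := tendsto_feasProb_one (show -(c + η) ≤ c + η + δ / σ by linarith) hR
      tendsto_const_nhds ((hD.div hSl hσ.ne').const_add (c + η))
    filter_upwards [hC, h1.eventually (lt_mem_nhds hlt), h2.eventually (lt_mem_nhds hlt)]
      with i hi e1 e2
    exact hi.2 _ _ (ci2Feasible_iff.mpr ⟨e1.le, e2.le⟩)
  · intro G hG _ a b hla hlb ha hb hab
    have h1 := tendsto_feasProb_one (show -a ≤ b + δ / σ by linarith) (hR.mono_left hG) hla
      (hlb.add ((hD.div hSu hσ.ne').mono_left hG))
    have h2 := tendsto_feasProb_one (show -b ≤ a + δ / σ by linarith) (hR.mono_left hG) hlb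
      (hla.add ((hD.div hSl hσ.ne').mono_left hG))
    have e1 := ge_of_tendsto h1 (hG (hC.mono fun i hi => (ci2Feasible_iff.mp hi.1).1))
    have e2 := ge_of_tendsto h2 (hG (hC.mono fun i hi => (ci2Feasible_iff.mp hi.1).2))
    have hab' : a + b ≤ 2 * c := by
      by_contra! hlt
      nlinarith
    exact eq_of_stdCDF_add_ge hd (hz0.trans_le ha) (hz0.trans_le hb) hab' (by linarith)
      (by linarith)

end Solution

section LimitLaw

instance isProbabilityMeasure_limitLaw (sl su r : ℝ) : IsProbabilityMeasure (limitLaw sl su r) :=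
  Measure.isProbabilityMeasure_map (by fun_prop)

lemma limitLaw_apply (sl su r : ℝ) {s : Set (ℝ × ℝ)} (hs : MeasurableSet s) :
    limitLaw sl su r s =
      stdPair {z | (sl * z.1, su * (r * z.1 + Real.sqrt (1 - r ^ 2) * z.2)) ∈ s} :=
  Measure.map_apply (by fun_prop) hs

variable {Ω : ℕ → Type*} [∀ k, MeasurableSpace (Ω k)] {Q : ∀ k, Measure (Ω k)}
  [∀ k, IsProbabilityMeasure (Q k)] {sl su r : ℝ} {X Y : (Σ k, Ω k) → ℝ}

lemma tendsto_cdf_linear {u v σ : ℝ} (hX : ∀ k, Measurable fun ω => X ⟨k, ω⟩)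
    (hY : ∀ k, Measurable fun ω => Y ⟨k, ω⟩)
    (h : ∀ g : BoundedContinuousFunction (ℝ × ℝ) ℝ,
      Tendsto (fun k => ∫ ω, g (X ⟨k, ω⟩, Y ⟨k, ω⟩) ∂(Q k)) atTop
        (𝓝 (∫ x, g x ∂(limitLaw sl su r))))
    (hσ : 0 < σ) (hr : r ∈ Set.Icc (-1 : ℝ) 1)
    (huv : (u * sl + v * su * r) ^ 2 + (v * su) ^ 2 * (1 - r ^ 2) = σ ^ 2) (x : ℝ) :
    Tendsto (fun k => (Q k).real {ω | u * X ⟨k, ω⟩ + v * Y ⟨k, ω⟩ ≤ x}) atTop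
      (𝓝 (stdCDF (x / σ))) := by
  have hr' : 0 ≤ 1 - r ^ 2 := by nlinarith [hr.1, hr.2]
  have hab : (u * sl + v * su * r) ^ 2 + (v * su * Real.sqrt (1 - r ^ 2)) ^ 2 = σ ^ 2 := by
    rw [mul_pow _ (Real.sqrt _), Real.sq_sqrt hr', huv]
  have hlin : ∀ z : ℝ × ℝ, u * (sl * z.1) + v * (su * (r * z.1 + Real.sqrt (1 - r ^ 2) * z.2)) =
      (u * sl + v * su * r) * z.1 + v * su * Real.sqrt (1 - r ^ 2) * z.2 := fun z => by ring
  have hnull : limitLaw sl su r {p | u * p.1 + v * p.2 = x} = 0 := by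
    rw [limitLaw_apply _ _ _ (measurableSet_eq_fun (by fun_prop) (by fun_prop))]
    simp only [Set.mem_ofPred_eq, hlin]
    exact measure_linear_eq_stdPair hσ hab x
  have hle : (limitLaw sl su r).real {p | u * p.1 + v * p.2 ≤ x} = stdCDF (x / σ) := by
    rw [measureReal_def, limitLaw_apply _ _ _ (measurableSet_le (by fun_prop) (by fun_prop))]
    simp only [Set.mem_ofPred_eq, hlin]
    exact measureReal_linear_le_stdPair hσ hab x
  rw [← hle]
  exact tendsto_measureReal_le_of_null (Z := fun p => (X p, Y p))
    (fun k => (hX k).prodMk (hY k)) h (f := fun p => u * p.1 + v * p.2) (by fun_prop) hnull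

/-- Ordered estimators of bounds at bounded distance are asymptotically perfectly dependent. -/
lemma eq_and_tendsto_sub_of_ordered {δ : ℕ → ℝ} {d : ℝ}
    (hX : ∀ k, Measurable fun ω => X ⟨k, ω⟩) (hY : ∀ k, Measurable fun ω => Y ⟨k, ω⟩)
    (h : ∀ g : BoundedContinuousFunction (ℝ × ℝ) ℝ,
      Tendsto (fun k => ∫ ω, g (X ⟨k, ω⟩, Y ⟨k, ω⟩) ∂(Q k)) atTop
        (𝓝 (∫ x, g x ∂(limitLaw sl su r))))
    (hsl : 0 < sl) (hsu : 0 < su) (hr : r ∈ Set.Icc (-1 : ℝ) 1)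
    (hδ : Tendsto δ atTop (𝓝 d)) (hord : ∀ᶠ p in highProb Q, X p ≤ Y p + δ p.1) :
    r = 1 ∧ su = sl ∧ Tendsto (fun p => Y p - X p) (highProb Q) (𝓝 0) := by
  have hZ : ∀ k, Measurable fun ω => (X ⟨k, ω⟩, Y ⟨k, ω⟩) := fun k => (hX k).prodMk (hY k)
  have := isOpenPosMeasure_stdPair
  set a := su * r - sl with ha
  set b := su * Real.sqrt (1 - r ^ 2) with hb
  have hlow : ∀ z : ℝ × ℝ, -d - 1 ≤ a * z.1 + b * z.2 := by
    have hO : IsOpen {p : ℝ × ℝ | p.2 - p.1 < -d - 1} :=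
      isOpen_lt (by fun_prop) (by fun_prop)
    have h0 := measure_eq_zero_of_eventually_notMem (Z := fun p => (X p, Y p)) hZ h hO (by
      filter_upwards [hord, (hδ.comp tendsto_fst_highProb).eventually
        (gt_mem_nhds (lt_add_one d))] with p h1 h2
      simp only [not_lt, Function.comp] at h2 ⊢
      linarith)
    rw [limitLaw_apply _ _ _ hO.measurableSet] at h0
    replace h0 := (IsOpen.measure_eq_zero_iff _ (hO.preimage (f := fun z : ℝ × ℝ =>
      (sl * z.1, su * (r * z.1 + Real.sqrt (1 - r ^ 2) * z.2))) (by fun_prop))).mp h0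
    intro z
    by_contra! hz
    have : z ∈ (∅ : Set (ℝ × ℝ)) := by
      rw [← h0]
      simp only [Set.mem_preimage, Set.mem_ofPred_eq]
      linarith
    exact this
  have hab : a ^ 2 + b ^ 2 = 0 := by
    by_contra hne
    have hpos : 0 < a ^ 2 + b ^ 2 := lt_of_le_of_ne (by positivity) (Ne.symm hne)
    have := hlow (-((|d| + 2) / (a ^ 2 + b ^ 2)) * a, -((|d| + 2) / (a ^ 2 + b ^ 2)) * b)
    have e : a * (-((|d| + 2) / (a ^ 2 + b ^ 2)) * a) + b * (-((|d| + 2) / (a ^ 2 + b ^ 2)) * b)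
        = -(|d| + 2) := by
      field_simp
      ring
    simp only [e] at this
    linarith [le_abs_self d]
  have ha0 : a = 0 := by nlinarith [sq_nonneg a, sq_nonneg b]
  have hb0 : b = 0 := by nlinarith [sq_nonneg a, sq_nonneg b]
  have hsq : Real.sqrt (1 - r ^ 2) = 0 := (mul_eq_zero.mp hb0).resolve_left hsu.ne'
  have hr1 : 1 ≤ r ^ 2 := by
    have := Real.sqrt_eq_zero'.mp hsq
    linarith
  have hrpos : 0 < r := by
    by_contra! hneg
    nlinarith
  obtain rfl : r = 1 := by nlinarith [hr.1, hr.2]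
  obtain rfl : su = sl := by linarith
  refine ⟨rfl, rfl, Metric.tendsto_nhds.mpr fun ε hε => ?_⟩
  have hC : IsClosed {p : ℝ × ℝ | ε ≤ |p.2 - p.1|} := isClosed_le (by fun_prop) (by fun_prop)
  have h0 : limitLaw su su 1 {p : ℝ × ℝ | ε ≤ |p.2 - p.1|} = 0 := by
    rw [limitLaw_apply _ _ _ hC.measurableSet]
    simp [not_le.mpr hε]
  filter_upwards [eventually_notMem_of_isClosed (Z := fun p => (X p, Y p)) hZ h hC h0] with p hp
  simpa using hp

lemma tendsto_highProb_of_tendsto_toReal {f : (Σ k, Ω k) → ℝ} {l : ℝ}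
    {P : ℝ → (Σ k, Ω k) → Prop}
    (h : ∀ ε, 0 < ε → Tendsto (fun k => (Q k {ω | P ε ⟨k, ω⟩}).toReal) atTop (𝓝 0))
    (hP : ∀ ε p, ε ≤ |f p - l| → P ε p) : Tendsto f (highProb Q) (𝓝 l) := by
  refine Metric.tendsto_nhds.mpr fun ε hε => ?_
  have h1 : ∀ᶠ p in highProb Q, ¬ P ε p := by
    rw [eventually_highProb_iff]
    simp only [not_not]
    exact (ENNReal.tendsto_toReal_iff (fun k => measure_ne_top _ _) ENNReal.zero_ne_top).mp (h ε hε)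
  filter_upwards [h1] with p hp
  rw [Real.dist_eq]
  exact not_le.mp fun hle => hp (hP ε p hle)

end LimitLaw

section Coverage

variable {Ω : ℕ → Type*} [∀ k, MeasurableSpace (Ω k)] {Q : ∀ k, Measure (Ω k)}
  [∀ k, IsProbabilityMeasure (Q k)] {X Y A B : (Σ k, Ω k) → ℝ} {S : Set (Σ k, Ω k)}
  {δ t : ℕ → ℝ} {σ T d c : ℝ}

lemma tendsto_stdCDF_div_atBot (hσ : 0 < σ) : Tendsto (fun x => stdCDF (x / σ)) atBot (𝓝 0) :=
  tendsto_stdCDF_atBot.comp (tendsto_id.atBot_div_const hσ)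

lemma continuous_stdCDF_div (σ : ℝ) : Continuous fun x => stdCDF (x / σ) :=
  continuous_stdCDF.comp (by fun_prop)

lemma tendsto_coverage_far {a : ℝ} (hσ : 0 < σ)
    (hcdf : ∀ x, Tendsto (fun k => (Q k).real {ω | X ⟨k, ω⟩ ≤ x}) atTop (𝓝 (stdCDF (x / σ))))
    (hS : ∀ᶠ p in highProb Q, p ∈ S ↔ X p - A p ≤ -t p.1 ∧ -t p.1 ≤ Y p + δ p.1 + B p)
    (hA : Tendsto A (highProb Q) (𝓝 a)) (ht : Tendsto t atTop atTop) :
    Tendsto (fun k => (Q k).real (Sigma.mk k ⁻¹' S)) atTop (𝓝 0) :=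
  tendsto_measureReal_le_atBot (tendsto_stdCDF_div_atBot hσ) hcdf
    (hA.add_atBot (tendsto_neg_atTop_atBot.comp (ht.comp tendsto_fst_highProb)))
    (hS.mono fun p hp h => by
      have := (hp.mp h).1
      simp only [Function.comp]
      linarith)

lemma tendsto_coverage_wide
    (hcdf : ∀ x, Tendsto (fun k => (Q k).real {ω | X ⟨k, ω⟩ ≤ x}) atTop (𝓝 (stdCDF (x / σ))))
    (hS : ∀ᶠ p in highProb Q, p ∈ S ↔ X p - A p ≤ -t p.1 ∧ -t p.1 ≤ Y p + δ p.1 + B p)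
    (hA : Tendsto A (highProb Q) (𝓝 (σ * c))) (ht : Tendsto t atTop (𝓝 T))
    (hYB : Tendsto (fun p => Y p + δ p.1 + B p) (highProb Q) atTop) :
    Tendsto (fun k => (Q k).real (Sigma.mk k ⁻¹' S)) atTop (𝓝 (stdCDF ((σ * c - T) / σ))) := by
  have ht' := ht.comp (tendsto_fst_highProb (Q := Q))
  refine tendsto_measureReal_le_random (G := fun x => stdCDF (x / σ))
    (continuous_stdCDF_div σ) hcdf (hA.sub ht') ?_
  filter_upwards [hS, hYB.eventually (eventually_ge_atTop (-T + 1)),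
    ht'.eventually (lt_mem_nhds (sub_one_lt T))] with p h1 h2 h3
  simp only [Function.comp] at h3 ⊢
  rw [h1, and_iff_left (by linarith)]
  constructor <;> intro _ <;> linarith

lemma tendsto_coverage_narrow (hX : ∀ k, Measurable fun ω => X ⟨k, ω⟩)
    (hcdf : ∀ x, Tendsto (fun k => (Q k).real {ω | X ⟨k, ω⟩ ≤ x}) atTop (𝓝 (stdCDF (x / σ))))
    (hS : ∀ᶠ p in highProb Q, p ∈ S ↔ X p - A p ≤ -t p.1 ∧ -t p.1 ≤ Y p + δ p.1 + B p)
    (hσ : 0 < σ) (hc : 0 < c) (hd : 0 ≤ d)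
    (hA : Tendsto A (highProb Q) (𝓝 (σ * c))) (hB : Tendsto B (highProb Q) (𝓝 (σ * c)))
    (hYX : Tendsto (fun p => Y p - X p) (highProb Q) (𝓝 0))
    (ht : Tendsto t atTop (𝓝 T)) (hδ : Tendsto δ atTop (𝓝 d)) :
    Tendsto (fun k => (Q k).real (Sigma.mk k ⁻¹' S)) atTop
      (𝓝 (stdCDF ((σ * c - T) / σ) - stdCDF ((-T - d - σ * c) / σ))) := by
  have ht' := ht.comp (tendsto_fst_highProb (Q := Q))
  have hδ' := hδ.comp (tendsto_fst_highProb (Q := Q))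
  have hV := ((ht'.neg.sub hδ').sub hB).sub hYX
  rw [sub_zero] at hV
  have hσc := mul_pos hσ hc
  refine tendsto_measureReal_between_random (G := fun x => stdCDF (x / σ))
    (continuous_stdCDF_div σ) hX hcdf hV (hA.sub ht')
    (by linarith) ?_
  filter_upwards [hS] with p h1
  simp only [Function.comp]
  rw [h1, and_comm]
  refine and_congr ?_ ?_ <;> constructor <;> intro _ <;> linarith

/-- Off the identified set, the label with the larger limiting standard deviation covers at least
as often in the limit. -/
lemma not_eventually_lt_coverage_sub {α b : ℝ} {X Y A B : Bool → (Σ k, Ω k) → ℝ}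
    {S : Bool → Set (Σ k, Ω k)} {σ : Bool → ℝ}
    (hX : ∀ J k, Measurable fun ω => X J ⟨k, ω⟩)
    (hcdf : ∀ J x, Tendsto (fun k => (Q k).real {ω | X J ⟨k, ω⟩ ≤ x}) atTop
      (𝓝 (stdCDF (x / σ J))))
    (hS : ∀ J, ∀ᶠ p in highProb Q,
      p ∈ S J ↔ X J p - A J p ≤ -t p.1 ∧ -t p.1 ≤ Y J p + δ p.1 + B J p)
    (hσ : ∀ J, 0 < σ J) (hσ' : σ true ≤ σ false) (ht0 : ∀ k, 0 ≤ t k)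
    (ht : Tendsto t atTop atTop ∨ ∃ T, Tendsto t atTop (𝓝 T))
    (hcase : (∃ z, ∀ J, Tendsto (A J) (highProb Q) (𝓝 (σ J * z)) ∧
        Tendsto (fun p => Y J p + δ p.1 + B J p) (highProb Q) atTop) ∨
      (∃ d, 0 ≤ d ∧ Tendsto δ atTop (𝓝 d) ∧ ∀ J, ∃ c, 0 < c ∧
        stdCDF c + stdCDF (c + d / σ J) = 2 - α ∧ Tendsto (A J) (highProb Q) (𝓝 (σ J * c)) ∧
        Tendsto (B J) (highProb Q) (𝓝 (σ J * c)) ∧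
        Tendsto (fun p => Y J p - X J p) (highProb Q) (𝓝 0)))
    (hb : 0 < b) : ¬ ∀ᶠ k in atTop, b < (Q k).real (Sigma.mk k ⁻¹' S true) -
      (Q k).real (Sigma.mk k ⁻¹' S false) := by
  suffices h : ∃ q : Bool → ℝ, (∀ J, Tendsto (fun k => (Q k).real (Sigma.mk k ⁻¹' S J)) atTop
      (𝓝 (q J))) ∧ q true ≤ q false by
    obtain ⟨q, hq, hle⟩ := h
    intro hev
    have := ge_of_tendsto ((hq true).sub (hq false)) (hev.mono fun _ => le_of_lt)
    linarith
  rcases ht with ht | ⟨T, ht⟩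
  · refine ⟨0, fun J => ?_, le_rfl⟩
    rcases hcase with ⟨z, h⟩ | ⟨d, -, -, h⟩
    · exact tendsto_coverage_far (hσ J) (hcdf J) (hS J) (h J).1 ht
    · obtain ⟨c, -, -, hA, -⟩ := h J
      exact tendsto_coverage_far (hσ J) (hcdf J) (hS J) hA ht
  have hT : 0 ≤ T := ge_of_tendsto' ht ht0
  rcases hcase with ⟨z, h⟩ | ⟨d, hd, hδ, h⟩
  · refine ⟨fun J => stdCDF ((σ J * z - T) / σ J), fun J =>
      tendsto_coverage_wide (hcdf J) (hS J) (h J).1 ht (h J).2, strictMono_stdCDF.monotone ?_⟩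
    have h1 := hσ true
    have h2 := hσ false
    rw [sub_div, sub_div, mul_div_cancel_left₀ _ h1.ne', mul_div_cancel_left₀ _ h2.ne']
    gcongr
  · choose c hc heq hA hB hYX using h
    refine ⟨fun J => stdCDF ((σ J * c J - T) / σ J) - stdCDF ((-T - d - σ J * c J) / σ J),
      fun J => tendsto_coverage_narrow (hX J) (hcdf J) (hS J) (hσ J) (hc J) hd (hA J) (hB J)
        (hYX J) ht hδ, ?_⟩
    exact limit_coverage_mono (hσ true) hσ' hd hT (hc true) ((heq true).trans (heq false).symm)

end Coverage

section Comparison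

variable {Ω : ℕ → Type*} [∀ k, MeasurableSpace (Ω k)] {Q : ∀ k, Measure (Ω k)}
  [∀ k, IsProbabilityMeasure (Q k)]

section SingleLabel

variable {α sl su r : ℝ} {δ : ℕ → ℝ} {X Y Sl Su R Cl Cu : (Σ k, Ω k) → ℝ}

lemma tendsto_critical_values_wide {z : ℝ} (hz : stdCDF z = 1 - α) (hsl : 0 < sl) (hsu : 0 < su)
    (hcdfX : ∀ x, Tendsto (fun k => (Q k).real {ω | -X ⟨k, ω⟩ ≤ x}) atTop (𝓝 (stdCDF (x / sl))))
    (hcdfY : ∀ x, Tendsto (fun k => (Q k).real {ω | Y ⟨k, ω⟩ ≤ x}) atTop (𝓝 (stdCDF (x / su))))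
    (hSl : Tendsto Sl (highProb Q) (𝓝 sl)) (hSu : Tendsto Su (highProb Q) (𝓝 su))
    (hR : Tendsto R (highProb Q) (𝓝 r)) (hδ : Tendsto δ atTop atTop)
    (hC : ∀ᶠ p in highProb Q, CI2Feasible α (R p) ((Y p - X p + δ p.1) / Su p)
        ((Y p - X p + δ p.1) / Sl p) (Cl p) (Cu p) ∧
      ∀ x y, CI2Feasible α (R p) ((Y p - X p + δ p.1) / Su p)
        ((Y p - X p + δ p.1) / Sl p) x y → Sl p * Cl p + Su p * Cu p ≤ Sl p * x + Su p * y) :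
    (Tendsto (fun p => Sl p * Cl p) (highProb Q) (𝓝 (sl * z)) ∧
      Tendsto (fun p => Y p + δ p.1 + Su p * Cu p) (highProb Q) atTop) ∧
    Tendsto (fun p => Su p * Cu p) (highProb Q) (𝓝 (su * z)) ∧
      Tendsto (fun p => -X p + δ p.1 + Sl p * Cl p) (highProb Q) atTop := by
  have hlow : ∀ {e : ℕ → ℝ}, Tendsto e atTop atTop →
      Tendsto (fun p => -X p + e p.1) (highProb Q) atTop := fun he =>
    tendsto_add_atTop_of_cdf (X := fun p => -X p) (tendsto_stdCDF_div_atBot hsl) hcdfX he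
  have hup : ∀ {e : ℕ → ℝ}, Tendsto e atTop atTop →
      Tendsto (fun p => Y p + e p.1) (highProb Q) atTop := fun he =>
    tendsto_add_atTop_of_cdf (X := Y) (tendsto_stdCDF_div_atBot hsu) hcdfY he
  have hhalf : Tendsto (fun k => δ k / 2) atTop atTop := hδ.atTop_div_const two_pos
  have hD : Tendsto (fun p => Y p - X p + δ p.1) (highProb Q) atTop := by
    refine ((hup hhalf).atTop_add_atTop (hlow hhalf)).congr fun p => ?_
    ring
  obtain ⟨h1, h2⟩ := tendsto_solution_wide hsl hsu hz hR hSl hSu hD hC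
  exact ⟨⟨hSl.mul h1, (hup hδ).atTop_add (hSu.mul h2)⟩,
    hSu.mul h2, (hlow hδ).atTop_add (hSl.mul h1)⟩

lemma tendsto_critical_values_narrow {d : ℝ} (hα : 0 < α) (hα' : α < 1 / 2)
    (hsl : 0 < sl) (hsu : 0 < su) (hr : r ∈ Set.Icc (-1 : ℝ) 1)
    (hX : ∀ k, Measurable fun ω => X ⟨k, ω⟩) (hY : ∀ k, Measurable fun ω => Y ⟨k, ω⟩)
    (h : ∀ g : BoundedContinuousFunction (ℝ × ℝ) ℝ,
      Tendsto (fun k => ∫ ω, g (X ⟨k, ω⟩, Y ⟨k, ω⟩) ∂(Q k)) atTop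
        (𝓝 (∫ x, g x ∂(limitLaw sl su r))))
    (hord : ∀ᶠ p in highProb Q, X p ≤ Y p + δ p.1)
    (hSl : Tendsto Sl (highProb Q) (𝓝 sl)) (hSu : Tendsto Su (highProb Q) (𝓝 su))
    (hR : Tendsto R (highProb Q) (𝓝 r)) (hδ : Tendsto δ atTop (𝓝 d)) (hd : 0 ≤ d)
    (hC : ∀ᶠ p in highProb Q, CI2Feasible α (R p) ((Y p - X p + δ p.1) / Su p)
        ((Y p - X p + δ p.1) / Sl p) (Cl p) (Cu p) ∧
      ∀ x y, CI2Feasible α (R p) ((Y p - X p + δ p.1) / Su p)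
        ((Y p - X p + δ p.1) / Sl p) x y → Sl p * Cl p + Su p * Cu p ≤ Sl p * x + Su p * y) :
    su = sl ∧ ∃ c, 0 < c ∧ stdCDF c + stdCDF (c + d / sl) = 2 - α ∧
      Tendsto (fun p => Sl p * Cl p) (highProb Q) (𝓝 (sl * c)) ∧
      Tendsto (fun p => Su p * Cu p) (highProb Q) (𝓝 (sl * c)) ∧
      Tendsto (fun p => Y p - X p) (highProb Q) (𝓝 0) := by
  obtain ⟨rfl, rfl, hYX⟩ := eq_and_tendsto_sub_of_ordered hX hY h hsl hsu hr hδ hord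
  have hD := hYX.add (hδ.comp tendsto_fst_highProb)
  rw [zero_add] at hD
  obtain ⟨c, hc0, hc⟩ := exists_stdCDF_add_eq hα hα' (div_nonneg hd hsl.le)
  obtain ⟨h1, h2⟩ := tendsto_solution_narrow hα hα' hsl hd hc0 hc hR hSl hSu hD hC
  exact ⟨rfl, c, hc0, hc, hSl.mul h1, hSu.mul h2, hYX⟩

end SingleLabel

variable {α b : ℝ} {sl su r : Bool → ℝ} {δ t : ℕ → ℝ}
  {X Y Sl Su R Cl Cu : Bool → (Σ k, Ω k) → ℝ} {S : Bool → Set (Σ k, Ω k)}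

/-- Comparison of the two intervals along a sequence on which all parameters converge. -/
lemma not_eventually_lt_coverage_sub_of_solution (hα : 0 < α) (hα' : α < 1 / 2)
    (hsl : ∀ J, 0 < sl J) (hsu : ∀ J, 0 < su J) (hr : ∀ J, r J ∈ Set.Icc (-1 : ℝ) 1)
    (hsl' : sl true ≤ sl false) (hsu' : su true ≤ su false)
    (hX : ∀ J k, Measurable fun ω => X J ⟨k, ω⟩) (hY : ∀ J k, Measurable fun ω => Y J ⟨k, ω⟩)
    (h : ∀ J, ∀ g : BoundedContinuousFunction (ℝ × ℝ) ℝ,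
      Tendsto (fun k => ∫ ω, g (X J ⟨k, ω⟩, Y J ⟨k, ω⟩) ∂(Q k)) atTop
        (𝓝 (∫ x, g x ∂(limitLaw (sl J) (su J) (r J)))))
    (hord : ∀ J, ∀ᶠ p in highProb Q, X J p ≤ Y J p + δ p.1)
    (hSl : ∀ J, Tendsto (Sl J) (highProb Q) (𝓝 (sl J)))
    (hSu : ∀ J, Tendsto (Su J) (highProb Q) (𝓝 (su J)))
    (hR : ∀ J, Tendsto (R J) (highProb Q) (𝓝 (r J)))
    (hδ0 : ∀ k, 0 ≤ δ k) (hδ : Tendsto δ atTop atTop ∨ ∃ d, Tendsto δ atTop (𝓝 d))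
    (ht0 : ∀ k, 0 ≤ t k) (ht : Tendsto t atTop atTop ∨ ∃ T, Tendsto t atTop (𝓝 T))
    (hC : ∀ J, ∀ᶠ p in highProb Q,
      CI2Feasible α (R J p) ((Y J p - X J p + δ p.1) / Su J p)
        ((Y J p - X J p + δ p.1) / Sl J p) (Cl J p) (Cu J p) ∧
      ∀ x y, CI2Feasible α (R J p) ((Y J p - X J p + δ p.1) / Su J p)
        ((Y J p - X J p + δ p.1) / Sl J p) x y →
        Sl J p * Cl J p + Su J p * Cu J p ≤ Sl J p * x + Su J p * y)
    (hS : (∀ J, ∀ᶠ p in highProb Q, p ∈ S J ↔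
        X J p - Sl J p * Cl J p ≤ -t p.1 ∧ -t p.1 ≤ Y J p + δ p.1 + Su J p * Cu J p) ∨
      (∀ J, ∀ᶠ p in highProb Q, p ∈ S J ↔
        -Y J p - Su J p * Cu J p ≤ -t p.1 ∧ -t p.1 ≤ -X J p + δ p.1 + Sl J p * Cl J p))
    (hb : 0 < b) : ¬ ∀ᶠ k in atTop, b < (Q k).real (Sigma.mk k ⁻¹' S true) -
      (Q k).real (Sigma.mk k ⁻¹' S false) := by
  obtain ⟨z, -, hz⟩ := exists_stdCDF_eq (p := 1 - α) (by linarith) (by linarith)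
  have cdfX : ∀ J x, Tendsto (fun k => (Q k).real {ω | X J ⟨k, ω⟩ ≤ x}) atTop
      (𝓝 (stdCDF (x / sl J))) := fun J => by
    simpa using tendsto_cdf_linear (u := 1) (v := 0) (hX J) (hY J) (h J) (hsl J) (hr J) (by ring)
  have cdfX' : ∀ J x, Tendsto (fun k => (Q k).real {ω | -X J ⟨k, ω⟩ ≤ x}) atTop
      (𝓝 (stdCDF (x / sl J))) := fun J => by
    simpa using tendsto_cdf_linear (u := -1) (v := 0) (hX J) (hY J) (h J) (hsl J) (hr J)
      (by ring)
  have cdfY : ∀ J x, Tendsto (fun k => (Q k).real {ω | Y J ⟨k, ω⟩ ≤ x}) atTop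
      (𝓝 (stdCDF (x / su J))) := fun J => by
    simpa using tendsto_cdf_linear (u := 0) (v := 1) (hX J) (hY J) (h J) (hsu J) (hr J) (by ring)
  have cdfY' : ∀ J x, Tendsto (fun k => (Q k).real {ω | -Y J ⟨k, ω⟩ ≤ x}) atTop
      (𝓝 (stdCDF (x / su J))) := fun J => by
    simpa using tendsto_cdf_linear (u := 0) (v := -1) (hX J) (hY J) (h J) (hsu J) (hr J)
      (by ring)
  rcases hδ with hδ | ⟨d, hδ⟩
  · have key := fun J => tendsto_critical_values_wide hz (hsl J) (hsu J) (cdfX' J) (cdfY J)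
      (hSl J) (hSu J) (hR J) hδ (hC J)
    rcases hS with hS | hS
    · exact not_eventually_lt_coverage_sub (α := α) hX cdfX hS hsl hsl' ht0 ht
        (Or.inl ⟨z, fun J => (key J).1⟩) hb
    · exact not_eventually_lt_coverage_sub (α := α) (X := fun J p => -Y J p)
        (Y := fun J p => -X J p) (fun J k => (hY J k).neg) cdfY' hS hsu hsu'
        ht0 ht (Or.inl ⟨z, fun J => (key J).2⟩) hb
  · have hd : 0 ≤ d := ge_of_tendsto' hδ hδ0
    have key := fun J => tendsto_critical_values_narrow hα hα' (hsl J) (hsu J) (hr J) (hX J)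
      (hY J) (h J) (hord J) (hSl J) (hSu J) (hR J) hδ hd (hC J)
    rcases hS with hS | hS
    · exact not_eventually_lt_coverage_sub hX cdfX hS hsl hsl' ht0 ht
        (Or.inr ⟨d, hd, hδ, fun J => (key J).2⟩) hb
    · refine not_eventually_lt_coverage_sub (α := α) (X := fun J p => -Y J p)
        (Y := fun J p => -X J p) (fun J k => (hY J k).neg) cdfY' hS hsu hsu'
        ht0 ht (Or.inr ⟨d, hd, hδ, fun J => ?_⟩) hb
      obtain ⟨heq, c, hc0, hc, hl, hu, hYX⟩ := key J
      rw [heq]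
      exact ⟨c, hc0, hc, hu, hl, hYX.congr fun p => by ring⟩

end Comparison

lemma tendsto_atTop_or_exists_of_tendsto_ofReal {t : ℕ → ℝ} (ht : ∀ k, 0 ≤ t k) {l : ENNReal}
    (h : Tendsto (fun k => ENNReal.ofReal (t k)) atTop (𝓝 l)) :
    Tendsto t atTop atTop ∨ ∃ T, Tendsto t atTop (𝓝 T) := by
  by_cases hl : l = ⊤
  · rw [hl] at h
    exact Or.inl (ENNReal.tendsto_ofReal_nhds_top.mp h)
  · refine Or.inr ⟨l.toReal, ((ENNReal.tendsto_toReal hl).comp h).congr fun k => ?_⟩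
    exact ENNReal.toReal_ofReal (ht k)

lemma coverage_iff {s l u a b x : ℝ} (hs : 0 < s) : (l - a / s ≤ x ∧ x ≤ u + b / s) ↔
    s * l - a ≤ s * x ∧ s * x ≤ s * u + b := by
  refine and_congr ?_ ?_
  · rw [← mul_le_mul_iff_right₀ hs, mul_sub, mul_div_cancel₀ _ hs.ne']
  · rw [← mul_le_mul_iff_right₀ hs, mul_add, mul_div_cancel₀ _ hs.ne']

/-- power comparison for `CI²_α`.  The label `J : Bool` indexes the two
estimators, with `true` standing for the efficient label `E` and `false` for the
inefficient label `I`.  Under the ordered-bounds setup (ordering `Q_N(L ≤ U) = 1`,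
uniform-subsequential asymptotic normality of the rescaled bound estimators with
limit law `(σ_l Z₁, σ_u(ρ Z₁ + √(1−ρ²) Z₂))`, consistency in probability of
`(S_l, S_u, R)`, variance bounds in `[σ̲, σ̄]`, `θ_u − θ_l ≤ Δ̄`), with the efficient
variances dominated by the inefficient ones, and `(C_l, C_u)` a.s. a solution of
Stoye's bivariate minimization problem, the coverage of the interval
`[L − S_l C_l/√N, U + S_u C_u/√N]` at points `θ_N ∉ [θ_{l,N}, θ_{u,N}]` satisfies
`liminf (Q_N(θ_N ∈ CI^E_N) − Q_N(θ_N ∈ CI^I_N)) ≤ 0`. -/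
theorem power_comparison_CI2
    (α σlo σhi Δbar : ℝ)
    (hα : 0 < α) (hα' : α < 1 / 2) (hσlo : 0 < σlo) (hσ : σlo ≤ σhi)
    (Ω : ℕ → Type) [∀ N, MeasurableSpace (Ω N)]
    (Q : ∀ N, Measure (Ω N)) [∀ N, IsProbabilityMeasure (Q N)]
    -- bound estimators, standard-error and correlation estimators, and critical
    -- values, for J ∈ {E, I}
    (L U Sl Su R Cl Cu : Bool → ∀ N : ℕ, Ω N → ℝ)
    (hmeas : ∀ J N, Measurable (L J N) ∧ Measurable (U J N) ∧ Measurable (Sl J N) ∧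
      Measurable (Su J N) ∧ Measurable (R J N) ∧ Measurable (Cl J N) ∧ Measurable (Cu J N))
    (hR : ∀ J N ω, R J N ω ∈ Set.Icc (-1 : ℝ) 1)
    -- population bounds and the parameter value under test
    (θl θu θ : ℕ → ℝ)
    (hθ : ∀ N, θl N ≤ θu N) (hΔ : ∀ N, θu N - θl N ≤ Δbar)
    (hout : ∀ N, θ N ∉ Set.Icc (θl N) (θu N))
    -- asymptotic variance parameters
    (σl σu ρ : Bool → ℕ → ℝ)
    (hσl : ∀ J N, σl J N ∈ Set.Icc σlo σhi) (hσu : ∀ J N, σu J N ∈ Set.Icc σlo σhi)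
    (hρ : ∀ J N, ρ J N ∈ Set.Icc (-1 : ℝ) 1)
    -- (i) ordering
    (hord : ∀ J N, Q N {ω | L J N ω ≤ U J N ω} = 1)
    -- the standard-error estimators are a.s. positive
    (hSpos : ∀ J N, ∀ᵐ ω ∂(Q N), 0 < Sl J N ω ∧ 0 < Su J N ω)
    -- (ii) efficiency comparison: label `true` (E) has smaller variances than `false` (I)
    (heffl : ∀ N, σl true N ≤ σl false N)
    (heffu : ∀ N, σu true N ≤ σu false N)
    -- (iii) along every subsequence where the variance parameters converge, the rescaled
    -- bounds converge in distribution to the limit law and `(S_l, S_u, R)` converges in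
    -- probability to the limit parameters
    (hconv : ∀ J : Bool, ∀ φ : ℕ → ℕ, StrictMono φ → ∀ sl su r : ℝ,
      Tendsto (fun k => (σl J (φ k), σu J (φ k), ρ J (φ k))) atTop (nhds (sl, su, r)) →
      ((∀ g : BoundedContinuousFunction (ℝ × ℝ) ℝ,
          Tendsto (fun k => ∫ ω, g (Real.sqrt (φ k) * (L J (φ k) ω - θl (φ k)),
              Real.sqrt (φ k) * (U J (φ k) ω - θu (φ k))) ∂(Q (φ k))) atTop
            (nhds (∫ x, g x ∂(limitLaw sl su r)))) ∧
        (∀ ε : ℝ, 0 < ε →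
          Tendsto (fun k =>
              (Q (φ k) {ω | ε ≤ |Sl J (φ k) ω - sl| ∨ ε ≤ |Su J (φ k) ω - su| ∨
                ε ≤ |R J (φ k) ω - r|}).toReal)
            atTop (nhds 0))))
    -- `(Cl J N, Cu J N)` is a.s. a minimizer of Stoye's bivariate problem: it is
    -- feasible and its objective value is minimal among all feasible pairs
    (hC : ∀ J N, ∀ᵐ ω ∂(Q N),
      CI2Feasible α (R J N ω)
          (Real.sqrt N * (U J N ω - L J N ω) / Su J N ω)
          (Real.sqrt N * (U J N ω - L J N ω) / Sl J N ω)
          (Cl J N ω) (Cu J N ω) ∧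
        ∀ cl cu : ℝ,
          CI2Feasible α (R J N ω)
            (Real.sqrt N * (U J N ω - L J N ω) / Su J N ω)
            (Real.sqrt N * (U J N ω - L J N ω) / Sl J N ω) cl cu →
          Sl J N ω * Cl J N ω + Su J N ω * Cu J N ω ≤ Sl J N ω * cl + Su J N ω * cu) :
    liminf (fun N : ℕ =>
      (Q N {ω | L true N ω - Sl true N ω * Cl true N ω / Real.sqrt N ≤ θ N ∧
          θ N ≤ U true N ω + Su true N ω * Cu true N ω / Real.sqrt N}).toReal -
      (Q N {ω | L false N ω - Sl false N ω * Cl false N ω / Real.sqrt N ≤ θ N ∧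
          θ N ≤ U false N ω + Su false N ω * Cu false N ω / Real.sqrt N}).toReal)
      atTop ≤ 0 := by
  by_contra! hpos
  have hbdd : IsBoundedUnder (· ≥ ·) atTop (fun N : ℕ =>
      (Q N {ω | L true N ω - Sl true N ω * Cl true N ω / Real.sqrt N ≤ θ N ∧
          θ N ≤ U true N ω + Su true N ω * Cu true N ω / Real.sqrt N}).toReal -
      (Q N {ω | L false N ω - Sl false N ω * Cl false N ω / Real.sqrt N ≤ θ N ∧
          θ N ≤ U false N ω + Su false N ω * Cu false N ω / Real.sqrt N}).toReal) := by
    refine isBoundedUnder_of ⟨-1, fun N => ?_⟩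
    have h1 := measureReal_nonneg (μ := Q N)
      (s := {ω | L true N ω - Sl true N ω * Cl true N ω / Real.sqrt N ≤ θ N ∧
          θ N ≤ U true N ω + Su true N ω * Cu true N ω / Real.sqrt N})
    have h2 := measureReal_le_one (μ := Q N)
      (s := {ω | L false N ω - Sl false N ω * Cl false N ω / Real.sqrt N ≤ θ N ∧
          θ N ≤ U false N ω + Su false N ω * Cu false N ω / Real.sqrt N})
    simp only [measureReal_def] at h1 h2
    linarith
  obtain ⟨b, hb, hlt⟩ := exists_between hpos
  have hev := eventually_lt_of_lt_liminf hlt hbdd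
  -- rescaled distance of `θ` from the identified set, and the side on which it lies
  set left : ℕ → Bool := fun N => decide (θ N < θl N)
  set τ : ℕ → ℝ := fun N => Real.sqrt N * (if left N then θl N - θ N else θ N - θu N) with hτ
  have hside : ∀ N, left N = false → θu N < θ N := by
    intro N hN
    by_contra! hle
    exact hout N ⟨not_lt.mp (of_decide_eq_false hN), hle⟩
  have hτ0 : ∀ N, 0 ≤ τ N := by
    intro N
    refine mul_nonneg (Real.sqrt_nonneg _) ?_
    split_ifs with h
    · exact sub_nonneg.mpr (of_decide_eq_true h).le
    · exact sub_nonneg.mpr (hside N (Bool.eq_false_of_not_eq_true h)).le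
  have hw0 : ∀ N : ℕ, 0 ≤ Real.sqrt N * (θu N - θl N) := fun N =>
    mul_nonneg (Real.sqrt_nonneg _) (sub_nonneg.mpr (hθ N))
  -- a subsequence along which every parameter converges
  have hcpt : IsCompact ((Set.univ.pi fun _ : Bool => Set.Icc σlo σhi ×ˢ Set.Icc σlo σhi ×ˢ
      Set.Icc (-1 : ℝ) 1) ×ˢ (Set.univ : Set (ENNReal × ENNReal × Bool))) :=
    (isCompact_univ_pi fun _ =>
      isCompact_Icc.prod (isCompact_Icc.prod isCompact_Icc)).prod isCompact_univ
  obtain ⟨⟨v, wlim, τlim, side⟩, ⟨hv, -⟩, φ, hφ, hlim⟩ := hcpt.tendsto_subseq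
    (x := fun N => (fun J => (σl J N, σu J N, ρ J N),
      ENNReal.ofReal (Real.sqrt N * (θu N - θl N)), ENNReal.ofReal (τ N), left N))
    fun N => ⟨fun J _ => ⟨hσl J N, hσu J N, hρ J N⟩, Set.mem_univ _⟩
  have hlimv : ∀ J, Tendsto (fun k => (σl J (φ k), σu J (φ k), ρ J (φ k))) atTop
      (𝓝 ((v J).1, (v J).2.1, (v J).2.2)) := fun J =>
    (tendsto_pi_nhds.mp ((continuous_fst.tendsto _).comp hlim)) J
  have hlim2 := (continuous_snd.tendsto _).comp hlim
  have hlimw : Tendsto (fun k => ENNReal.ofReal (Real.sqrt (φ k) * (θu (φ k) - θl (φ k)))) atTop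
      (𝓝 wlim) := (continuous_fst.tendsto _).comp hlim2
  have hlim3 := (continuous_snd.tendsto _).comp hlim2
  have hlimτ : Tendsto (fun k => ENNReal.ofReal (τ (φ k))) atTop (𝓝 τlim) :=
    (continuous_fst.tendsto _).comp hlim3
  have hlims : ∀ᶠ k in atTop, left (φ k) = side := by
    have h : Tendsto (fun k => left (φ k)) atTop (𝓝 side) :=
      (continuous_snd.tendsto _).comp hlim3
    rwa [nhds_discrete, tendsto_pure] at h
  have hvJ : ∀ J, v J ∈ Set.Icc σlo σhi ×ˢ Set.Icc σlo σhi ×ˢ Set.Icc (-1 : ℝ) 1 := fun J =>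
    hv J (Set.mem_univ J)
  have hconvφ := fun J => hconv J φ hφ _ _ _ (hlimv J)
  have hl1 : ∀ J, Tendsto (fun k => σl J (φ k)) atTop (𝓝 (v J).1) := fun J =>
    (continuous_fst.tendsto _).comp (hlimv J)
  have hl2 : ∀ J, Tendsto (fun k => σu J (φ k)) atTop (𝓝 (v J).2.1) := fun J =>
    (continuous_fst.tendsto _).comp ((continuous_snd.tendsto _).comp (hlimv J))
  have hpositive : ∀ᶠ p in highProb (fun k => Q (φ k)), 0 < Real.sqrt (φ p.1) := by
    filter_upwards [tendsto_fst_highProb.eventually (eventually_ge_atTop 1)] with p hp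
    exact Real.sqrt_pos.mpr (by exact_mod_cast hp.trans (hφ.le_apply))
  have hlSl : ∀ J, Tendsto (fun p : Σ k, Ω (φ k) => Sl J (φ p.1) p.2)
      (highProb fun k => Q (φ k)) (𝓝 (v J).1) := fun J =>
    tendsto_highProb_of_tendsto_toReal
      (P := fun ε p => ε ≤ |Sl J (φ p.1) p.2 - (v J).1| ∨ ε ≤ |Su J (φ p.1) p.2 - (v J).2.1| ∨
        ε ≤ |R J (φ p.1) p.2 - (v J).2.2|) (hconvφ J).2 fun _ _ => Or.inl
  have hlSu : ∀ J, Tendsto (fun p : Σ k, Ω (φ k) => Su J (φ p.1) p.2)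
      (highProb fun k => Q (φ k)) (𝓝 (v J).2.1) := fun J =>
    tendsto_highProb_of_tendsto_toReal
      (P := fun ε p => ε ≤ |Sl J (φ p.1) p.2 - (v J).1| ∨ ε ≤ |Su J (φ p.1) p.2 - (v J).2.1| ∨
        ε ≤ |R J (φ p.1) p.2 - (v J).2.2|) (hconvφ J).2 fun _ _ h => Or.inr (Or.inl h)
  have hlR : ∀ J, Tendsto (fun p : Σ k, Ω (φ k) => R J (φ p.1) p.2)
      (highProb fun k => Q (φ k)) (𝓝 (v J).2.2) := fun J =>
    tendsto_highProb_of_tendsto_toReal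
      (P := fun ε p => ε ≤ |Sl J (φ p.1) p.2 - (v J).1| ∨ ε ≤ |Su J (φ p.1) p.2 - (v J).2.1| ∨
        ε ≤ |R J (φ p.1) p.2 - (v J).2.2|) (hconvφ J).2 fun _ _ h => Or.inr (Or.inr h)
  refine not_eventually_lt_coverage_sub_of_solution (Q := fun k => Q (φ k)) (b := b)
    (sl := fun J => (v J).1) (su := fun J => (v J).2.1) (r := fun J => (v J).2.2)
    (δ := fun k => Real.sqrt (φ k) * (θu (φ k) - θl (φ k))) (t := fun k => τ (φ k))
    (X := fun J p => Real.sqrt (φ p.1) * (L J (φ p.1) p.2 - θl (φ p.1)))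
    (Y := fun J p => Real.sqrt (φ p.1) * (U J (φ p.1) p.2 - θu (φ p.1)))
    (Sl := fun J p => Sl J (φ p.1) p.2) (Su := fun J p => Su J (φ p.1) p.2)
    (R := fun J p => R J (φ p.1) p.2) (Cl := fun J p => Cl J (φ p.1) p.2)
    (Cu := fun J p => Cu J (φ p.1) p.2)
    (S := fun J => {p | L J (φ p.1) p.2 -
        Sl J (φ p.1) p.2 * Cl J (φ p.1) p.2 / Real.sqrt (φ p.1) ≤ θ (φ p.1) ∧
      θ (φ p.1) ≤ U J (φ p.1) p.2 +
        Su J (φ p.1) p.2 * Cu J (φ p.1) p.2 / Real.sqrt (φ p.1)})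
    hα hα' (fun J => hσlo.trans_le (hvJ J).1.1) (fun J => hσlo.trans_le (hvJ J).2.1.1)
    (fun J => (hvJ J).2.2)
    (le_of_tendsto_of_tendsto' (hl1 true) (hl1 false) fun k => heffl (φ k))
    (le_of_tendsto_of_tendsto' (hl2 true) (hl2 false) fun k => heffu (φ k))
    (fun J k => ((hmeas J (φ k)).1.sub_const (θl (φ k))).const_mul (Real.sqrt (φ k)))
    (fun J k => ((hmeas J (φ k)).2.1.sub_const (θu (φ k))).const_mul (Real.sqrt (φ k)))
    (fun J => (hconvφ J).1) (fun J => ?_)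
    hlSl hlSu hlR
    (fun k => hw0 (φ k))
    (tendsto_atTop_or_exists_of_tendsto_ofReal (fun k => hw0 (φ k)) hlimw)
    (fun k => hτ0 (φ k)) (tendsto_atTop_or_exists_of_tendsto_ofReal (fun k => hτ0 (φ k)) hlimτ)
    (fun J => ?_) ?_ hb (hφ.tendsto_atTop.eventually hev)
  · refine eventually_highProb_of_ae fun k => ?_
    have hord' : ∀ᵐ ω ∂(Q (φ k)), L J (φ k) ω ≤ U J (φ k) ω :=
      (mem_ae_iff_prob_eq_one (measurableSet_le (hmeas J _).1 (hmeas J _).2.1)).mpr (hord J (φ k))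
    filter_upwards [hord'] with ω hω
    have := mul_le_mul_of_nonneg_left hω (Real.sqrt_nonneg (φ k))
    linarith
  · refine eventually_highProb_of_ae fun k => ?_
    filter_upwards [hC J (φ k)] with ω hω
    have e : Real.sqrt (φ k) * (U J (φ k) ω - θu (φ k)) - Real.sqrt (φ k) *
        (L J (φ k) ω - θl (φ k)) + Real.sqrt (φ k) * (θu (φ k) - θl (φ k)) =
        Real.sqrt (φ k) * (U J (φ k) ω - L J (φ k) ω) := by ring
    simp only [e]
    exact hω
  · have hsidep := tendsto_fst_highProb (Q := fun k => Q (φ k)) |>.eventually hlims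
    cases side with
    | true =>
      refine Or.inl fun J => ?_
      filter_upwards [hpositive, hsidep] with p hp hs
      have hτp : τ (φ p.1) = Real.sqrt (φ p.1) * (θl (φ p.1) - θ (φ p.1)) := by simp [hτ, hs]
      rw [hτp, coverage_iff hp]
      refine and_congr ?_ ?_ <;> constructor <;> intro _ <;> linarith
    | false =>
      refine Or.inr fun J => ?_
      filter_upwards [hpositive, hsidep] with p hp hs
      have hτp : τ (φ p.1) = Real.sqrt (φ p.1) * (θ (φ p.1) - θu (φ p.1)) := by simp [hτ, hs]
      rw [hτp, coverage_iff hp, and_comm]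
      refine and_congr ?_ ?_ <;> constructor <;> intro _ <;> linarith
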